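/- arXiv:2403.03301 — 2 statements merged into one kernel-verified Lean document; each statement's English description precedes it below -/
import Mathlib

section
/- Let p be a prime with p \equiv 1 mod 4. Write p = u^2 + v^2 with v even, and choose signs of u, v so that u + v i is a p-adic unit in Z_p (i a fixed square root of -1). Then \sum_{k=0}^{p-1} \binom{2k}{k}^2 (-1/16)^k \equiv (-1)^{(u-v-1)/2} (u + v i) mod p^2 in Z_p. -/
open Finset

open Polynomial in
lemma coeff_comp_neg_X {R : Type*} [CommRing R] (f : R[X]) (k : ℕ) :
    (f.comp (-X)).coeff k = (-1) ^ k * f.coeff k := by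
  have h : (-X : R[X]) = C (-1) * X := by simp
  rw [h, comp_C_mul_X_coeff, mul_comm]

open Polynomial in
lemma coeff_one_sub_X_pow (N k : ℕ) :
    ((1 - X : ℤ[X]) ^ N).coeff k = (-1) ^ k * N.choose k := by
  have h : (1 - X : ℤ[X]) ^ N = ((1 + X) ^ N : ℤ[X]).comp (-X) := by
    simp [sub_eq_add_neg]
  rw [h, coeff_comp_neg_X, coeff_one_add_X_pow]

open Polynomial in
lemma coeff_one_sub_X_sq_pow (N m : ℕ) :
    ((1 - X ^ 2 : ℤ[X]) ^ N).coeff (2 * m) = (-1) ^ m * N.choose m := by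
  have h : (1 - X ^ 2 : ℤ[X]) ^ N = expand ℤ 2 ((1 - X) ^ N) := by simp
  rw [h, mul_comm, coeff_expand_mul (by norm_num), coeff_one_sub_X_pow]

open Polynomial in
lemma alternating_sum_choose_mul_choose (N n : ℕ) :
    ∑ k ∈ range (n + 1), (-1 : ℤ) ^ k * N.choose k * n.choose k =
      ((1 - X : ℤ[X]) ^ N * (1 + X) ^ n).coeff n := by
  rw [coeff_mul, Finset.Nat.sum_antidiagonal_eq_sum_range_succ_mk]
  refine sum_congr rfl fun k hk => ?_
  have hk : k ≤ n := by simpa [Nat.lt_succ_iff] using hk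
  rw [coeff_one_sub_X_pow, coeff_one_add_X_pow, Nat.choose_symm hk]

lemma alternating_sum_choose_sq (m : ℕ) :
    ∑ k ∈ range (2 * m + 1), (-1 : ℤ) ^ k * (2 * m).choose k * (2 * m).choose k =
      (-1) ^ m * (2 * m).choose m := by
  rw [alternating_sum_choose_mul_choose, ← coeff_one_sub_X_sq_pow, ← mul_pow]
  congr 2
  ring

open Polynomial in
/-- Only the even part of `(1 - X) ^ p` contributes to the even coefficients of
`(1 - X) ^ (2 * m + p) * (1 + X) ^ (2 * m)`, and modulo `p ^ 2` that even part is
`(1 + (1 - X ^ 2) ^ p) / 2` in degrees below `p`. -/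
lemma alternating_sum_choose_add_prime (p m : ℕ) (hp : p.Prime) (hodd : Odd p) (hm : 2 * m < p) :
    (p : ℤ) ^ 2 ∣ 2 * ∑ k ∈ range (2 * m + 1),
        (-1 : ℤ) ^ k * (2 * m + p).choose k * (2 * m).choose k
      - (-1) ^ m * ((2 * m).choose m + (2 * m + p).choose m) := by
  obtain ⟨α, hα⟩ := exists_add_pow_prime_eq hp (1 : ℤ[X]) (-X)
  obtain ⟨β, hβ⟩ := exists_add_pow_prime_eq hp (1 : ℤ[X]) X
  rw [hodd.neg_pow] at hα
  have hsymm : ((1 - X ^ 2 : ℤ[X]) ^ (2 * m) * (1 - X) ^ p).coeff (2 * m) =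
      ((1 - X ^ 2 : ℤ[X]) ^ (2 * m) * (1 + X) ^ p).coeff (2 * m) := by
    have h : (1 - X ^ 2 : ℤ[X]) ^ (2 * m) * (1 - X) ^ p =
        ((1 - X ^ 2 : ℤ[X]) ^ (2 * m) * (1 + X) ^ p).comp (-X) := by
      simp [sub_eq_add_neg]
    rw [h, coeff_comp_neg_X]
    simp
  have hexp : (1 - X ^ 2 : ℤ[X]) ^ (2 * m) * (1 - X) ^ p
      + (1 - X ^ 2 : ℤ[X]) ^ (2 * m) * (1 + X) ^ p =
      (1 - X ^ 2) ^ (2 * m) + (1 - X ^ 2) ^ (2 * m + p)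
      + ((1 - X ^ 2) ^ (2 * m) * (X ^ p + (p : ℤ[X]) * X * α + (p : ℤ[X]) * X * β)) * X ^ p
      + C ((p : ℤ) ^ 2) * ((1 - X ^ 2) ^ (2 * m) * (X ^ 2 * α * β)) := by
    have h : (1 - X ^ 2 : ℤ[X]) ^ (2 * m + p) =
        (1 - X ^ 2) ^ (2 * m) * ((1 - X) ^ p * (1 + X) ^ p) := by
      rw [pow_add, ← mul_pow]; congr 2; ring
    rw [h, hβ, sub_eq_add_neg 1 (X : ℤ[X]), hα]
    simp only [map_pow, map_natCast]
    ring
  have hfac : (1 - X : ℤ[X]) ^ (2 * m + p) * (1 + X) ^ (2 * m) =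
      (1 - X ^ 2) ^ (2 * m) * (1 - X) ^ p := by
    have h : (1 - X ^ 2 : ℤ[X]) = (1 - X) * (1 + X) := by ring
    rw [h, mul_pow, pow_add]; ring
  have hc := congrArg (fun f : ℤ[X] => f.coeff (2 * m)) hexp
  simp only [coeff_add] at hc
  rw [← hsymm, coeff_mul_X_pow', if_neg (by omega), coeff_C_mul, coeff_one_sub_X_sq_pow,
    coeff_one_sub_X_sq_pow] at hc
  rw [alternating_sum_choose_mul_choose, hfac]
  exact ⟨((1 - X ^ 2) ^ (2 * m) * (X ^ 2 * α * β)).coeff (2 * m), by linear_combination hc⟩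

section Padic

variable {p : ℕ} [Fact p.Prime]

lemma isUnit_natCast_padicInt {k : ℕ} (hk : ¬ p ∣ k) : IsUnit (k : ℤ_[p]) := by
  rw [PadicInt.isUnit_iff, PadicInt.norm_natCast_eq_one_iff]
  exact (Nat.Prime.coprime_iff_not_dvd Fact.out).2 hk

lemma isUnit_factorial_padicInt {k : ℕ} (hk : k < p) : IsUnit (k.factorial : ℤ_[p]) :=
  isUnit_natCast_padicInt fun h => absurd ((Nat.Prime.dvd_factorial Fact.out).1 h) (by omega)

lemma descPochhammer_eval_natCast_padicInt (n k : ℕ) :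
    (descPochhammer ℤ_[p] k).eval (n : ℤ_[p]) = k.factorial * n.choose k := by
  rw [descPochhammer_eval_eq_descFactorial, Nat.descFactorial_eq_factorial_mul_choose]
  push_cast; rfl

lemma descPochhammer_eval_neg_half {R : Type*} [CommRing R] {h : R} (hh : 2 * h = 1) (k : ℕ) :
    (descPochhammer R k).eval (-h) = k.factorial * (k.centralBinom * (-h ^ 2) ^ k) := by
  induction k with
  | zero => simp
  | succ k ih =>
    have hs : ((k : R) + 1) * (k + 1).centralBinom = 2 * (2 * k + 1) * k.centralBinom := by
      exact_mod_cast congrArg (Nat.cast (R := R)) (Nat.succ_mul_centralBinom_succ k)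
    rw [descPochhammer_succ_eval, ih, Nat.factorial_succ]
    push_cast
    linear_combination (-(k.factorial * (-h ^ 2) ^ (k + 1) : R)) * hs +
      (k.factorial * (-h^2)^k * k.centralBinom * (h * (2 * k + 1) + k) : R) * hh

lemma choose_add_prime_modEq (n : ℕ) {k : ℕ} (hk : k < p) :
    (p : ℤ_[p]) ∣ (n + p).choose k - n.choose k := by
  rw [← (isUnit_factorial_padicInt hk).dvd_mul_left, mul_sub,
    ← descPochhammer_eval_natCast_padicInt, ← descPochhammer_eval_natCast_padicInt]
  simpa using Polynomial.sub_dvd_eval_sub ((n + p : ℕ) : ℤ_[p]) n (descPochhammer ℤ_[p] k)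

/-- `binom(-1/2, k) ≡ (3 binom(n, k) - binom(n + p, k)) / 2` modulo `p ^ 2`, for
`n = (p - 1) / 2`. -/
lemma centralBinom_modEq {n k : ℕ} (hn : p = 2 * n + 1) {h : ℤ_[p]} (hh : 2 * h = 1)
    (hk : k < p) :
    (p : ℤ_[p]) ^ 2 ∣ 2 * (k.centralBinom * (-h ^ 2) ^ k)
      - (3 * n.choose k - (n + p).choose k) := by
  rw [← (isUnit_factorial_padicInt hk).dvd_mul_left]
  have hp : (p : ℤ_[p]) = 2 * n + 1 := by exact_mod_cast congrArg (Nat.cast (R := ℤ_[p])) hn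
  obtain ⟨a, ha⟩ := Polynomial.binomExpansion (descPochhammer ℤ_[p] k) n (-h * p)
  obtain ⟨b, hb⟩ := Polynomial.binomExpansion (descPochhammer ℤ_[p] k) n p
  rw [show (n : ℤ_[p]) + -h * p = -h by rw [hp]; linear_combination (-n : ℤ_[p]) * hh,
    descPochhammer_eval_neg_half hh, descPochhammer_eval_natCast_padicInt] at ha
  rw [← Nat.cast_add, descPochhammer_eval_natCast_padicInt,
    descPochhammer_eval_natCast_padicInt] at hb
  refine ⟨2 * a * h ^ 2 + b, ?_⟩
  linear_combination 2 * ha + hb -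
    (Polynomial.eval (n : ℤ_[p]) (Polynomial.derivative (descPochhammer ℤ_[p] k)) * p) * hh

lemma sq_centralBinom_modEq {n k : ℕ} (hn : p = 2 * n + 1) {h : ℤ_[p]} (hh : 2 * h = 1)
    (hk : k < p) :
    (p : ℤ_[p]) ^ 2 ∣ (k.centralBinom * (-h ^ 2) ^ k) ^ 2
      - (2 * n.choose k * n.choose k - (n + p).choose k * n.choose k) := by
  obtain ⟨a, ha⟩ := centralBinom_modEq hn hh hk
  obtain ⟨b, hb⟩ := choose_add_prime_modEq n hk
  set x : ℤ_[p] := k.centralBinom * (-h ^ 2) ^ k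
  have hx : x - n.choose k = p * (h * (p * a - b)) := by
    linear_combination h * ha - h * hb - (x - n.choose k) * hh
  refine ⟨(h * (p * a - b)) ^ 2 + a * n.choose k, ?_⟩
  linear_combination (x - n.choose k + p * (h * (p * a - b))) * hx + (n.choose k : ℤ_[p]) * ha

lemma two_mul_sum_centralBinom_modEq {m : ℕ} (hm : p = 4 * m + 1) {h : ℤ_[p]} (hh : 2 * h = 1) :
    (p : ℤ_[p]) ^ 2 ∣ 2 * ∑ k ∈ range p, (-1) ^ k * (k.centralBinom * (-h ^ 2) ^ k) ^ 2
      - (-1) ^ m * (3 * (2 * m).choose m - (2 * m + p).choose m) := by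
  have h1 : (p : ℤ_[p]) ^ 2 ∣ ∑ k ∈ range p, (-1) ^ k * ((k.centralBinom * (-h ^ 2) ^ k) ^ 2
      - (2 * (2 * m).choose k * (2 * m).choose k - (2 * m + p).choose k * (2 * m).choose k)) :=
    dvd_sum fun k hk => dvd_mul_of_dvd_right
      (sq_centralBinom_modEq (by omega) hh (mem_range.1 hk)) _
  have hsub (N : ℕ) : ∑ k ∈ range p, (-1 : ℤ_[p]) ^ k * N.choose k * (2 * m).choose k =
      ((∑ k ∈ range (2 * m + 1), (-1 : ℤ) ^ k * N.choose k * (2 * m).choose k : ℤ) : ℤ_[p]) := by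
    push_cast
    symm
    refine sum_subset (range_subset_range.2 (by omega)) fun k _ hk => ?_
    rw [Nat.choose_eq_zero_of_lt (n := 2 * m) (by simpa using hk)]
    simp
  have h2 := map_dvd (Int.castRingHom ℤ_[p]) (alternating_sum_choose_add_prime p m Fact.out
    ⟨2 * m, by omega⟩ (by omega))
  have h3 := congrArg (Int.cast (R := ℤ_[p])) (alternating_sum_choose_sq m)
  rw [← hsub] at h3
  simp only [map_sub, map_mul, map_add, eq_intCast, map_pow] at h2
  rw [← hsub] at h2
  push_cast at h2 h3
  have h4 : ∑ k ∈ range p, (-1) ^ k * ((k.centralBinom * (-h ^ 2) ^ k) ^ 2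
      - (2 * (2 * m).choose k * (2 * m).choose k - (2 * m + p).choose k * (2 * m).choose k)) =
      ∑ k ∈ range p, (-1) ^ k * ((k.centralBinom : ℤ_[p]) * (-h ^ 2) ^ k) ^ 2
      - 2 * ∑ k ∈ range p, (-1 : ℤ_[p]) ^ k * (2 * m).choose k * (2 * m).choose k
      + ∑ k ∈ range p, (-1 : ℤ_[p]) ^ k * (2 * m + p).choose k * (2 * m).choose k := by
    rw [mul_sum, ← sum_sub_distrib, ← sum_add_distrib]
    exact sum_congr rfl fun k _ => by ring
  rw [h4] at h1
  convert (dvd_sub (h1.mul_left 2) h2) using 1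
  linear_combination 4 * h3

lemma toZMod_eq_zero_iff_dvd {x : ℤ_[p]} : PadicInt.toZMod x = 0 ↔ (p : ℤ_[p]) ∣ x := by
  rw [← RingHom.mem_ker, PadicInt.ker_toZMod, PadicInt.maximalIdeal_eq_span_p,
    Ideal.mem_span_singleton]

lemma isUnit_iff_toZMod_ne_zero {x : ℤ_[p]} : IsUnit x ↔ PadicInt.toZMod x ≠ 0 := by
  rw [Ne, toZMod_eq_zero_iff_dvd, ← PadicInt.norm_lt_one_iff_dvd, ← PadicInt.not_isUnit_iff,
    not_not]

variable (p) in
/-- The Teichmüller character, obtained from a Hensel lift of a generator of `(ZMod p)ˣ`. -/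
lemma exists_teichmuller_mulChar :
    ∃ T : MulChar (ZMod p) ℤ_[p], ∀ x, PadicInt.toZMod (T x) = x := by
  obtain ⟨g, hg⟩ := IsCyclic.exists_generator (α := (ZMod p)ˣ)
  have hp2 : 2 ≤ p := (Fact.out : p.Prime).two_le
  obtain ⟨a, ha⟩ : ∃ a : ℤ_[p], PadicInt.toZMod a = g := ⟨((g : ZMod p).val : ℤ_[p]), by simp⟩
  have hpow : ‖a ^ (p - 1) - 1‖ < 1 := by
    rw [PadicInt.norm_lt_one_iff_dvd, ← toZMod_eq_zero_iff_dvd, map_sub, map_pow, ha, map_one,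
      ZMod.pow_card_sub_one_eq_one g.ne_zero, sub_self]
  have hder : ‖((p - 1 : ℕ) : ℤ_[p]) * a ^ (p - 1 - 1)‖ = 1 := by
    rw [← PadicInt.isUnit_iff, isUnit_iff_toZMod_ne_zero, map_mul, map_pow, ha, map_natCast]
    refine mul_ne_zero ?_ (pow_ne_zero _ g.ne_zero)
    rw [Ne, ZMod.natCast_eq_zero_iff]
    exact Nat.not_dvd_of_pos_of_lt (by omega) (by omega)
  have hder' : ‖Polynomial.aeval a
      (Polynomial.derivative (Polynomial.X ^ (p - 1) - 1 : Polynomial ℤ_[p]))‖ = 1 := by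
    rw [← hder]
    simp only [map_sub, Polynomial.derivative_X_pow, Polynomial.derivative_one, sub_zero,
      Polynomial.coe_aeval_eq_eval, Polynomial.eval_mul, Polynomial.eval_pow, Polynomial.eval_X,
      Polynomial.eval_C]
  obtain ⟨z, hz, hza, -⟩ := hensels_lemma (p := p)
    (F := (Polynomial.X ^ (p - 1) - 1 : Polynomial ℤ_[p])) (a := a) (by
      rw [hder']
      simpa using hpow)
  rw [hder', PadicInt.norm_lt_one_iff_dvd, ← toZMod_eq_zero_iff_dvd, map_sub, ha,
    sub_eq_zero] at hza
  have hz1 : z ^ (p - 1) = 1 := by simpa [sub_eq_zero] using hz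
  have hcard : Fintype.card (ZMod p)ˣ = p - 1 := ZMod.card_units p
  let ζ : ℤ_[p]ˣ := Units.ofPowEqOne z (p - 1) hz1 (by omega)
  have hζ : ζ ∈ rootsOfUnity (Fintype.card (ZMod p)ˣ) ℤ_[p] := by
    rw [mem_rootsOfUnity, hcard]
    exact Units.pow_ofPowEqOne hz1 _
  let T := MulChar.ofRootOfUnity hζ hg
  let ι : MulChar (ZMod p) (ZMod p) := MulChar.ofUnitHom (MonoidHom.id _)
  have hT : T.ringHomComp PadicInt.toZMod = ι := by
    rw [MulChar.eq_iff hg, MulChar.ringHomComp_apply, MulChar.ofRootOfUnity_spec]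
    simpa [ι, ζ] using hza
  refine ⟨T, fun x => ?_⟩
  have hx := DFunLike.congr_fun hT x
  rw [MulChar.ringHomComp_apply] at hx
  rw [hx]
  by_cases h0 : x = 0
  · rw [h0, MulChar.map_zero]
  · exact MulChar.ofUnitHom_coe (MonoidHom.id (ZMod p)ˣ) (Units.mk0 x h0)

section Teichmuller

variable {T : MulChar (ZMod p) ℤ_[p]} (hT : ∀ x, PadicInt.toZMod (T x) = x)
include hT

lemma teichmuller_pow_eq_one_iff (N : ℕ) : T ^ N = 1 ↔ p - 1 ∣ N := by
  constructor
  · intro h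
    obtain ⟨g, hg⟩ := IsCyclic.exists_generator (α := (ZMod p)ˣ)
    have hord : orderOf g = p - 1 := by
      rw [orderOf_eq_card_of_forall_mem_zpowers hg, Nat.card_eq_fintype_card, ZMod.card_units]
    rw [← hord, orderOf_dvd_iff_pow_eq_one]
    have h2 := congrArg PadicInt.toZMod (DFunLike.congr_fun h (g : ZMod p))
    rw [MulChar.pow_apply_coe, map_pow, hT, MulChar.one_apply_coe, map_one] at h2
    exact Units.ext (by simpa using h2)
  · rintro ⟨c, rfl⟩
    have h := T.pow_card_eq_one
    rw [ZMod.card_units] at h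
    rw [pow_mul, h, one_pow]

lemma sum_teichmuller_pow {N : ℕ} (hN : N ≠ 0) :
    ∑ x, T x ^ N = if p - 1 ∣ N then (p : ℤ_[p]) - 1 else 0 := by
  simp_rw [← MulChar.pow_apply' T hN]
  split_ifs with h
  · rw [(teichmuller_pow_eq_one_iff hT N).2 h, MulChar.sum_one_eq_card_units, ZMod.card_units,
      Nat.cast_sub (Fact.out : p.Prime).one_le, Nat.cast_one]
  · exact MulChar.sum_eq_zero_of_ne_one (mt (teichmuller_pow_eq_one_iff hT N).1 h)

lemma sum_teichmuller_pow_mul {m : ℕ} (hm : p = 4 * m + 1) (hm0 : m ≠ 0) (M : ℕ) :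
    ∑ x, T x ^ (3 * m) * (1 - T x) ^ M =
      (p - 1) * ∑ k ∈ range (M + 1) with 4 * m ∣ 3 * m + k, (-1) ^ k * (M.choose k : ℤ_[p]) := by
  have h (x : ZMod p) : T x ^ (3 * m) * (1 - T x) ^ M =
      ∑ k ∈ range (M + 1), (-1) ^ k * (M.choose k : ℤ_[p]) * T x ^ (3 * m + k) := by
    rw [sub_eq_neg_add, add_pow, mul_sum]
    refine sum_congr rfl fun k _ => ?_
    rw [neg_pow, one_pow]
    ring
  simp_rw [h]
  rw [sum_comm, mul_sum, sum_filter]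
  refine sum_congr rfl fun k _ => ?_
  rw [← mul_sum, sum_teichmuller_pow hT (by omega), show p - 1 = 4 * m by omega]
  split_ifs <;> ring

lemma two_mul_teichmuller_pow_modEq {m : ℕ} (hm : p = 4 * m + 1) (hm0 : m ≠ 0) (x : ZMod p) :
    (p : ℤ_[p]) ^ 2 ∣
      2 * T (1 - x) ^ (2 * m) - (3 * (1 - T x) ^ (2 * m) - (1 - T x) ^ (6 * m)) := by
  by_cases hx : x = 1
  · subst hx
    have h0 : T 0 = 0 := T.map_nonunit not_isUnit_zero
    simp [hm0, h0]
  obtain ⟨y, hy⟩ : (p : ℤ_[p]) ∣ (1 - T x) ^ (2 * m) - T (1 - x) ^ (2 * m) := by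
    rw [← toZMod_eq_zero_iff_dvd]
    simp [hT]
  set s := T (1 - x) ^ (2 * m)
  have hs : s ^ 2 = 1 := by
    have h1 : T ^ (4 * m) = 1 := (teichmuller_pow_eq_one_iff hT _).2 ⟨1, by omega⟩
    rw [← pow_mul, show 2 * m * 2 = 4 * m by ring, ← MulChar.pow_apply' T (by omega), h1]
    exact MulChar.one_apply (IsUnit.mk0 _ (sub_ne_zero.2 (Ne.symm hx)))
  have h6 : (1 - T x) ^ (6 * m) = ((1 - T x) ^ (2 * m)) ^ 3 := by
    rw [← pow_mul]; congr 1; ring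
  rw [h6, sub_eq_iff_eq_add.1 hy]
  refine ⟨(3 * s + p * y) * y ^ 2, ?_⟩
  linear_combination (3 * p * y + s) * hs

lemma two_mul_jacobiSum_modEq {m : ℕ} (hm : p = 4 * m + 1) (hm0 : m ≠ 0) :
    (p : ℤ_[p]) ^ 2 ∣ 2 * jacobiSum (T ^ (3 * m)) (T ^ (2 * m))
      - (p - 1) * ((-1) ^ m * (3 * (2 * m).choose m - 2 * (6 * m).choose m)) := by
  have h2 : ∑ k ∈ range (2 * m + 1) with 4 * m ∣ 3 * m + k,
      (-1) ^ k * ((2 * m).choose k : ℤ_[p]) = (-1) ^ m * (2 * m).choose m := by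
    have : {k ∈ range (2 * m + 1) | 4 * m ∣ 3 * m + k} = {m} := by
      ext k
      simp only [mem_filter, mem_range, mem_singleton]
      constructor
      · rintro ⟨hk, c, hc⟩
        have h1 : 0 < c := by by_contra!; interval_cases c; omega
        have h3 : c < 2 := by
          by_contra! h
          have := Nat.mul_le_mul_left (4 * m) h
          omega
        interval_cases c; omega
      · rintro rfl
        exact ⟨by omega, 1, by ring⟩
    rw [this, sum_singleton]
  have h6 : ∑ k ∈ range (6 * m + 1) with 4 * m ∣ 3 * m + k,
      (-1) ^ k * ((6 * m).choose k : ℤ_[p]) = (-1) ^ m * (2 * (6 * m).choose m) := by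
    have : {k ∈ range (6 * m + 1) | 4 * m ∣ 3 * m + k} = {m, 5 * m} := by
      ext k
      simp only [mem_filter, mem_range, mem_insert, mem_singleton]
      constructor
      · rintro ⟨hk, c, hc⟩
        have h1 : 0 < c := by by_contra!; interval_cases c; omega
        have h3 : c < 3 := by
          by_contra! h
          have := Nat.mul_le_mul_left (4 * m) h
          omega
        interval_cases c <;> omega
      · rintro (rfl | rfl)
        · exact ⟨by omega, 1, by ring⟩
        · exact ⟨by omega, 2, by ring⟩
    rw [this, sum_pair (by omega), ← Nat.choose_symm (show 5 * m ≤ 6 * m by omega),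
      show 6 * m - 5 * m = m by omega, show 5 * m = m + 2 * (2 * m) by ring, pow_add, pow_mul]
    ring
  have hsum : 2 * jacobiSum (T ^ (3 * m)) (T ^ (2 * m))
      - (p - 1) * ((-1) ^ m * (3 * (2 * m).choose m - 2 * (6 * m).choose m)) =
      ∑ x, T x ^ (3 * m) *
        (2 * T (1 - x) ^ (2 * m) - (3 * (1 - T x) ^ (2 * m) - (1 - T x) ^ (6 * m))) := by
    have e2 := sum_teichmuller_pow_mul hT hm hm0 (2 * m)
    have e6 := sum_teichmuller_pow_mul hT hm hm0 (6 * m)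
    rw [h2] at e2
    rw [h6] at e6
    have hJ : jacobiSum (T ^ (3 * m)) (T ^ (2 * m)) =
        ∑ x, T x ^ (3 * m) * T (1 - x) ^ (2 * m) := by
      rw [jacobiSum]
      exact sum_congr rfl fun x _ => by
        rw [MulChar.pow_apply' T (by omega), MulChar.pow_apply' T (by omega)]
    have e : ∑ x, T x ^ (3 * m) *
        (2 * T (1 - x) ^ (2 * m) - (3 * (1 - T x) ^ (2 * m) - (1 - T x) ^ (6 * m))) =
        2 * ∑ x, T x ^ (3 * m) * T (1 - x) ^ (2 * m)
        - 3 * ∑ x, T x ^ (3 * m) * (1 - T x) ^ (2 * m)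
        + ∑ x, T x ^ (3 * m) * (1 - T x) ^ (6 * m) := by
      rw [mul_sum, mul_sum, ← sum_sub_distrib, ← sum_add_distrib]
      exact sum_congr rfl fun x _ => by ring
    rw [e, hJ, e2, e6]
    ring
  rw [hsum]
  exact dvd_sum fun x _ => dvd_mul_of_dvd_right (two_mul_teichmuller_pow_modEq hT hm hm0 x) _

end Teichmuller
end Padic

lemma gaussianInt_sqrtd_sq : (Zsqrtd.sqrtd : GaussianInt) ^ 2 = -1 := by
  decide

lemma gaussianInt_sub_one_dvd_of_pow_four_eq_one {z : GaussianInt} (hz : z ^ 4 = 1) :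
    (Zsqrtd.sqrtd - 1 : GaussianInt) ∣ z - 1 := by
  set I : GaussianInt := Zsqrtd.sqrtd
  have hI : I ^ 2 = -1 := gaussianInt_sqrtd_sq
  have h : (z - 1) * (z + 1) * (z - I) * (z + I) = 0 := by
    linear_combination hz - (z ^ 2 - 1) * hI
  simp only [mul_eq_zero, sub_eq_zero, add_eq_zero_iff_eq_neg] at h
  rcases h with ((rfl | rfl) | rfl) | rfl
  · simp
  · exact ⟨I + 1, by linear_combination -hI⟩
  · exact dvd_rfl
  · exact ⟨I, by linear_combination -hI⟩

section JacobiSum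

variable {F : Type*} [Field F] [Fintype F]

lemma norm_jacobiSum_gaussianInt [DecidableEq F] {χ ψ : MulChar F GaussianInt}
    (hF : ringChar F ≠ 0)
    (hχ : χ ≠ 1) (hψ : ψ ≠ 1) (hχψ : χ * ψ ≠ 1) :
    (jacobiSum χ ψ).norm = Fintype.card F := by
  have hinj : Function.Injective GaussianInt.toComplex := GaussianInt.toComplex_injective
  have h := jacobiSum_mul_jacobiSum_inv (F := F) (F' := ℂ)
    (by rw [ringChar.eq_zero]; exact hF.symm)
    (χ := χ.ringHomComp GaussianInt.toComplex) (φ := ψ.ringHomComp GaussianInt.toComplex)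
    ((MulChar.ringHomComp_ne_one_iff hinj).2 hχ) ((MulChar.ringHomComp_ne_one_iff hinj).2 hψ)
    (by rw [← MulChar.ringHomComp_mul]; exact (MulChar.ringHomComp_ne_one_iff hinj).2 hχψ)
  rw [← MulChar.star_eq_inv, ← MulChar.star_eq_inv] at h
  have hstar (η θ : MulChar F ℂ) : jacobiSum (star η) (star θ) = star (jacobiSum η θ) := by
    simp [jacobiSum]
  rw [hstar, jacobiSum_ringHomComp, Complex.star_def, ← GaussianInt.toComplex_star,
    ← map_mul, ← map_natCast GaussianInt.toComplex] at h
  have h2 := hinj h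
  rw [← Zsqrtd.norm_eq_mul_conj] at h2
  exact_mod_cast h2

lemma dvd_jacobiSum_add_card_gaussianInt [DecidableEq F] {χ ψ : MulChar F GaussianInt}
    (hχ : χ ≠ 1) (hψ : ψ ≠ 1) (hχ4 : χ ^ 4 = 1) (hψ2 : ψ ^ 2 = 1) :
    (2 * (Zsqrtd.sqrtd - 1) : GaussianInt) ∣ jacobiSum χ ψ + Fintype.card F := by
  have h : jacobiSum χ ψ + Fintype.card F = ∑ x, (ψ (1 - x) - 1) * (χ x - 1) := by
    have e : ∑ x, ψ (1 - x) = 0 := by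
      rw [← MulChar.sum_eq_zero_of_ne_one hψ]
      exact (Equiv.subLeft (1 : F)).sum_comp ψ
    have e2 : ∑ x, (ψ (1 - x) - 1) * (χ x - 1) =
        ∑ x, χ x * ψ (1 - x) - ∑ x, ψ (1 - x) - ∑ x, χ x + ∑ x : F, 1 := by
      rw [← sum_sub_distrib, ← sum_sub_distrib, ← sum_add_distrib]
      exact sum_congr rfl fun x _ => by ring
    rw [e2, e, MulChar.sum_eq_zero_of_ne_one hχ, jacobiSum]
    simp
  rw [h]
  refine dvd_sum fun x _ => ?_
  by_cases h0 : x = 0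
  · simp [h0]
  by_cases h1 : x = 1
  · simp [h1]
  have hx : IsUnit x := IsUnit.mk0 _ h0
  have hx1 : IsUnit (1 - x) := IsUnit.mk0 _ (sub_ne_zero.2 (Ne.symm h1))
  refine mul_dvd_mul ?_ (gaussianInt_sub_one_dvd_of_pow_four_eq_one ?_)
  · have : ψ (1 - x) ^ 2 = 1 := by
      rw [← MulChar.pow_apply' ψ two_ne_zero, hψ2, MulChar.one_apply hx1]
    rw [sq, mul_self_eq_one_iff] at this
    rcases this with h | h
    · simp [h]
    · exact ⟨-1, by rw [h]; ring⟩
  · rw [← MulChar.pow_apply' χ four_ne_zero, hχ4, MulChar.one_apply hx]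

end JacobiSum

/-- Representations of `p` as a sum of two squares are unique up to the units of `ℤ[i]`. -/
lemma eq_or_eq_neg_of_sq_add_sq {p : ℕ} [Fact p.Prime] {i : ℤ_[p]} (hi : i ^ 2 = -1)
    {a b u v : ℤ} (hp2 : p ≠ 2) (hab : (p : ℤ) = a ^ 2 + b ^ 2) (huv : (p : ℤ) = u ^ 2 + v ^ 2)
    (hb : Even b) (hv : Even v)
    (hunitab : IsUnit ((a : ℤ_[p]) + b * i)) (hunit : IsUnit ((u : ℤ_[p]) + v * i)) :
    (a = u ∧ b = v) ∨ (a = -u ∧ b = -v) := by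
  have hp : p.Prime := Fact.out
  have hp0 : (0 : ℤ) < p := by exact_mod_cast hp.pos
  have hconj {c d : ℤ} (hcd : (p : ℤ) = c ^ 2 + d ^ 2) (hu : IsUnit ((c : ℤ_[p]) + d * i)) :
      (p : ℤ_[p]) ∣ c - d * i := by
    rw [← hu.dvd_mul_left]
    refine ⟨1, ?_⟩
    have : (p : ℤ_[p]) = c ^ 2 + d ^ 2 := by exact_mod_cast congrArg (Int.cast (R := ℤ_[p])) hcd
    rw [this]
    linear_combination (-(d : ℤ_[p]) ^ 2) * hi
  obtain ⟨r, hr⟩ := hconj hab hunitab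
  obtain ⟨s, hs⟩ := hconj huv hunit
  have h2 : IsUnit ((2 : ℕ) : ℤ_[p]) := by
    rw [PadicInt.isUnit_iff, PadicInt.norm_natCast_eq_one_iff]
    exact (Nat.coprime_primes hp Nat.prime_two).2 hp2
  have hdvd : (p : ℤ) ∣ a * v - b * u := by
    rw [← PadicInt.norm_int_lt_one_iff_dvd, PadicInt.norm_lt_one_iff_dvd,
      ← (h2.mul (IsUnit.of_mul_eq_one (-i) (by linear_combination -hi : i * -i = 1))).dvd_mul_left]
    refine ⟨r * (u + v * i) - s * (a + b * i), ?_⟩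
    push_cast
    linear_combination (u + v * i : ℤ_[p]) * hr - (a + b * i : ℤ_[p]) * hs
  obtain ⟨c, hc⟩ := hdvd
  have hpodd : ¬ Even (p : ℤ) := by
    rw [Int.even_coe_nat]
    exact fun h => hp2 (hp.even_iff.1 h)
  have hid : (a * u + b * v) ^ 2 + (p * c) ^ 2 = (p : ℤ) ^ 2 := by
    rw [← hc]
    linear_combination (-(p : ℤ)) * hab - (a ^ 2 + b ^ 2) * huv
  have hceven : Even c := by
    have : Even ((p : ℤ) * c) := by
      rw [← hc]
      exact (hv.mul_left a).sub (hb.mul_right u)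
    exact (Int.even_mul.1 this).resolve_left hpodd
  have hc0 : c = 0 := by
    have h1 : (p : ℤ) ^ 2 * c ^ 2 ≤ p ^ 2 * 1 := by nlinarith [sq_nonneg (a * u + b * v)]
    have h2 : c ^ 2 ≤ 1 ^ 2 := by
      simpa using le_of_mul_le_mul_left h1 (by positivity)
    have h3 := abs_le_of_sq_le_sq' h2 zero_le_one
    obtain ⟨d, rfl⟩ := hceven
    omega
  rw [hc0, mul_zero, sub_eq_zero] at hc
  rw [hc0, mul_zero, zero_pow two_ne_zero, add_zero, sq_eq_sq_iff_eq_or_eq_neg] at hid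
  rcases hid with h | h
  · left
    constructor <;> refine mul_left_cancel₀ hp0.ne' ?_
    · linear_combination a * huv + v * hc + u * h
    · linear_combination b * huv - u * hc + v * h
  · right
    constructor <;> refine mul_left_cancel₀ hp0.ne' ?_
    · linear_combination a * huv + v * hc + u * h
    · linear_combination b * huv - u * hc + v * h

section Padic

variable {p : ℕ} [Fact p.Prime]

/-- A quartic character with values in `ℤ[i]` lifting the `3 m`-th power of the Teichmüller
character. -/
lemma exists_gaussianInt_mulChar {T : MulChar (ZMod p) ℤ_[p]}
    (hT : ∀ x, PadicInt.toZMod (T x) = x) {m : ℕ} (hm : p = 4 * m + 1) (hm0 : m ≠ 0)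
    {i : ℤ_[p]} (hi : i ^ 2 = -1) (f : GaussianInt →+* ℤ_[p]) (hf : f Zsqrtd.sqrtd = i) :
    ∃ χ : MulChar (ZMod p) GaussianInt, χ.ringHomComp f = T ^ (3 * m) ∧ χ ^ 4 = 1 := by
  obtain ⟨g, hg⟩ := IsCyclic.exists_generator (α := (ZMod p)ˣ)
  have h4 : (T ^ (3 * m)) g ^ 4 = 1 := by
    rw [← MulChar.pow_apply_coe, ← pow_mul, (teichmuller_pow_eq_one_iff hT _).2 ⟨3, by omega⟩,
      MulChar.one_apply_coe]
  have h2 : (T ^ (3 * m)) g ^ 2 ≠ 1 := by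
    rw [← MulChar.pow_apply_coe, ← pow_mul]
    intro h
    have h1 : T ^ (3 * m * 2) = 1 := by
      rw [MulChar.eq_iff hg, h, MulChar.one_apply_coe]
    obtain ⟨c, hc⟩ := (teichmuller_pow_eq_one_iff hT _).1 h1
    have h3 : 6 * m = 4 * m * c := by rw [← show p - 1 = 4 * m by omega, ← hc]; ring
    have h5 : 0 < m := Nat.pos_of_ne_zero hm0
    have h6 : 3 = 2 * c := by
      refine Nat.eq_of_mul_eq_mul_left (show 0 < 2 * m by omega) ?_
      linarith
    omega
  set w := (T ^ (3 * m)) g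
  have hz : ∃ z : GaussianInt, f z = w ∧ z ^ 4 = 1 := by
    have h : (w ^ 2 - 1) * ((w - i) * (w + i)) = 0 := by
      linear_combination h4 - (w ^ 2 - 1) * hi
    rcases mul_eq_zero.1 ((mul_eq_zero.1 h).resolve_left (sub_ne_zero.2 h2)) with h | h
    · exact ⟨Zsqrtd.sqrtd, by rw [hf, sub_eq_zero.1 h], by decide⟩
    · exact ⟨-Zsqrtd.sqrtd, by rw [map_neg, hf, eq_neg_of_add_eq_zero_left h], by decide⟩
  obtain ⟨z, hfz, hz4⟩ := hz
  let ζ : GaussianIntˣ := Units.ofPowEqOne z 4 hz4 four_ne_zero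
  have hζ4 : ζ ^ 4 = 1 := Units.pow_ofPowEqOne hz4 _
  have hζ : ζ ∈ rootsOfUnity (Fintype.card (ZMod p)ˣ) GaussianInt := by
    rw [mem_rootsOfUnity, ZMod.card_units, show p - 1 = 4 * m by omega, pow_mul, hζ4, one_pow]
  refine ⟨MulChar.ofRootOfUnity hζ hg, ?_, ?_⟩
  · rw [MulChar.eq_iff hg, MulChar.ringHomComp_apply, MulChar.ofRootOfUnity_spec]
    exact hfz
  · rw [MulChar.eq_iff hg, MulChar.pow_apply_coe, MulChar.ofRootOfUnity_spec,
      MulChar.one_apply_coe]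
    exact hz4

/-- The Jacobi sum `J(T ^ (3 m), T ^ (2 m))` lies in `ℤ[i]`, has norm `p`, and is congruent to
`-1` modulo `2 + 2 i`. -/
lemma exists_jacobiSum_teichmuller_eq {T : MulChar (ZMod p) ℤ_[p]}
    (hT : ∀ x, PadicInt.toZMod (T x) = x) {m : ℕ} (hm : p = 4 * m + 1) (hm0 : m ≠ 0)
    {i : ℤ_[p]} (hi : i ^ 2 = -1) :
    ∃ a b : ℤ, jacobiSum (T ^ (3 * m)) (T ^ (2 * m)) = -((a : ℤ_[p]) + b * i) ∧
      (p : ℤ) = a ^ 2 + b ^ 2 ∧ Even b ∧ (a - b) % 4 = 1 := by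
  let f : GaussianInt →+* ℤ_[p] := Zsqrtd.lift ⟨i, by rw [← sq, hi]; simp⟩
  have hf (z : GaussianInt) : f z = z.re + z.im * i := rfl
  obtain ⟨χ, hχ, hχ4⟩ := exists_gaussianInt_mulChar hT hm hm0 hi f (by simp [hf])
  have hχ2 : (χ ^ 2).ringHomComp f = T ^ (2 * m) := by
    rw [← MulChar.ringHomComp_pow, hχ, ← pow_mul, show 3 * m * 2 = 2 * m + (p - 1) by omega,
      pow_add, (teichmuller_pow_eq_one_iff hT _).2 dvd_rfl, mul_one]
  have hne {k : ℕ} (hk : ¬ 4 ∣ 3 * k) : χ ^ k ≠ 1 := by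
    intro h
    have h1 : (χ ^ k).ringHomComp f = 1 := by rw [h, MulChar.ringHomComp_one]
    rw [← MulChar.ringHomComp_pow, hχ, ← pow_mul, teichmuller_pow_eq_one_iff hT,
      show p - 1 = m * 4 by omega, show 3 * m * k = m * (3 * k) by ring,
      Nat.mul_dvd_mul_iff_left (Nat.pos_of_ne_zero hm0)] at h1
    exact hk h1
  have hχ1 : χ ≠ 1 := by simpa using hne (k := 1) (by norm_num)
  have hnorm := norm_jacobiSum_gaussianInt (χ := χ) (ψ := χ ^ 2)
    (by rw [ZMod.ringChar_zmod_n]; omega) hχ1 (hne (by norm_num))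
    (by rw [← pow_succ']; exact hne (by norm_num))
  have hdvd := dvd_jacobiSum_add_card_gaussianInt (χ := χ) (ψ := χ ^ 2) hχ1 (hne (by norm_num))
    hχ4 (by rw [← pow_mul, hχ4])
  have hJ := jacobiSum_ringHomComp χ (χ ^ 2) f
  rw [hχ, hχ2] at hJ
  rw [ZMod.card] at hnorm hdvd
  set J := jacobiSum χ (χ ^ 2)
  obtain ⟨w, hw⟩ := hdvd
  have hre := congrArg Zsqrtd.re hw
  have him := congrArg Zsqrtd.im hw
  simp [Zsqrtd.re_mul, Zsqrtd.im_mul] at hre him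
  rw [Zsqrtd.norm_def] at hnorm
  refine ⟨-J.re, -J.im, ?_, by linear_combination -hnorm, ?_, ?_⟩
  · rw [hJ, hf]
    push_cast
    ring
  · rw [even_neg]
    exact ⟨w.re - w.im, by linear_combination him⟩
  · have : (p : ℤ) = 4 * m + 1 := by exact_mod_cast hm
    omega

lemma sum_centralBinom_add_jacobiSum {T : MulChar (ZMod p) ℤ_[p]}
    (hT : ∀ x, PadicInt.toZMod (T x) = x) {m : ℕ} (hm : p = 4 * m + 1) (hm0 : m ≠ 0)
    {h : ℤ_[p]} (hh : 2 * h = 1) :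
    (p : ℤ_[p]) ^ 2 ∣ ∑ k ∈ range p, (-1) ^ k * (k.centralBinom * (-h ^ 2) ^ k) ^ 2
      + jacobiSum (T ^ (3 * m)) (T ^ (2 * m)) := by
  obtain ⟨a, ha⟩ := two_mul_sum_centralBinom_modEq hm hh
  obtain ⟨b, hb⟩ := two_mul_jacobiSum_modEq hT hm hm0
  obtain ⟨t, ht⟩ := choose_add_prime_modEq (2 * m) (show m < p by omega)
  have hunit : IsUnit ((5 * m + 1 : ℕ) : ℤ_[p]) := isUnit_natCast_padicInt fun hd => by
    have h1 : p ∣ m := (Nat.dvd_add_right (dvd_refl p)).1 (by rwa [show p + m = 5 * m + 1 by omega])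
    exact absurd (Nat.le_of_dvd (Nat.pos_of_ne_zero hm0) h1) (by omega)
  have hp : (p : ℤ_[p]) = 4 * m + 1 := by exact_mod_cast congrArg (Nat.cast (R := ℤ_[p])) hm
  have hDC : ((2 * m + p).choose m : ℤ_[p]) * (5 * m + 1) = (6 * m).choose m * (6 * m + 1) := by
    have h1 := Nat.choose_mul_succ_eq (6 * m) m
    rw [show 6 * m + 1 - m = 5 * m + 1 by omega, show 6 * m + 1 = 2 * m + p by omega] at h1
    have h2 := congrArg (Nat.cast (R := ℤ_[p])) h1
    push_cast at h2
    rw [← h2, hp]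
    ring
  have key : (p : ℤ_[p]) ^ 2 ∣ (3 * (2 * m).choose m - (2 * m + p).choose m)
      + (p - 1) * (3 * (2 * m).choose m - 2 * (6 * m).choose m) := by
    rw [← hunit.dvd_mul_left]
    push_cast
    refine ⟨2 * (6 * m).choose m - 3 * t * (5 * m + 1), ?_⟩
    linear_combination (3 * p - 1 : ℤ_[p]) * hDC - (3 * p * (5 * m + 1) : ℤ_[p]) * ht
      - ((6 * m).choose m * (1 + 2 * p) : ℤ_[p]) * hp
  obtain ⟨c, hc⟩ := key
  refine ⟨h * (a + b + (-1) ^ m * c), ?_⟩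
  linear_combination h * (ha + hb) + h * (-1) ^ m * hc -
    (∑ k ∈ range p, (-1) ^ k * (k.centralBinom * (-h ^ 2) ^ k) ^ 2
      + jacobiSum (T ^ (3 * m)) (T ^ (2 * m))) * hh

lemma isUnit_sum_centralBinom {m : ℕ} (hm : p = 4 * m + 1) {h : ℤ_[p]} (hh : 2 * h = 1) :
    IsUnit (∑ k ∈ range p, (-1) ^ k * ((k.centralBinom : ℤ_[p]) * (-h ^ 2) ^ k) ^ 2) := by
  obtain ⟨a, ha⟩ := two_mul_sum_centralBinom_modEq hm hh
  obtain ⟨t, ht⟩ := choose_add_prime_modEq (2 * m) (show m < p by omega)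
  have h2 : ¬ p ∣ (2 * m).choose m := fun hd => by
    have h1 : p ∣ (2 * m).factorial := by
      rw [← Nat.choose_mul_factorial_mul_factorial (show m ≤ 2 * m by omega), mul_assoc]
      exact dvd_mul_of_dvd_left hd _
    exact absurd ((Nat.Prime.dvd_factorial Fact.out).1 h1) (by omega)
  have hB := isUnit_natCast_padicInt h2
  rw [isUnit_iff_toZMod_ne_zero, Ne, toZMod_eq_zero_iff_dvd] at hB ⊢
  rintro ⟨c, hc⟩
  refine hB ⟨h * ((-1) ^ m * (2 * c - p * a) + t), ?_⟩
  rw [hc] at ha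
  have hs : ((-1 : ℤ_[p]) ^ m) ^ 2 = 1 := by rw [← pow_mul, mul_comm, pow_mul]; simp
  linear_combination (-(h * (-1) ^ m)) * ha
    - h * (3 * (2 * m).choose m - (2 * m + p).choose m) * hs + h * ht
    - ((2 * m).choose m : ℤ_[p]) * hh

end Padic

/-- Van Hamme (1986): for `p ≡ 1 mod 4`, `p = u² + v²` with `v` even and `u + v i`
a `p`-adic unit, `∑_{k<p} binom(2k,k)² (-1/16)^k ≡ (-1)^((u-v-1)/2) (u + v i) mod p²`. -/
theorem stmt_2 (p : ℕ) [Fact p.Prime] (hp4 : p % 4 = 1) (u v : ℤ) (i : ℤ_[p])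
    (hi : i ^ 2 = -1) (huv : (p : ℤ) = u ^ 2 + v ^ 2) (hv : Even v)
    (hunit : IsUnit ((u : ℤ_[p]) + v * i)) :
    (p : ℤ_[p]) ^ 2 ∣
      (∑ k ∈ Finset.range p,
          ((Nat.choose (2 * k) k : ℤ_[p]) ^ 2 * (-(Ring.inverse (16 : ℤ_[p]))) ^ k))
        - (-1 : ℤ_[p]) ^ ((u - v - 1) / 2).natAbs * ((u : ℤ_[p]) + v * i) := by
  have hp : p.Prime := Fact.out
  obtain ⟨m, hm⟩ : ∃ m, p = 4 * m + 1 := ⟨p / 4, by omega⟩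
  have hm0 : m ≠ 0 := by
    rintro rfl
    exact hp.one_lt.ne' hm
  obtain ⟨h, hh⟩ : ∃ h : ℤ_[p], 2 * h = 1 := by
    have h2 : IsUnit ((2 : ℕ) : ℤ_[p]) := isUnit_natCast_padicInt fun hd => by
      have := Nat.le_of_dvd two_pos hd
      omega
    exact_mod_cast h2.exists_right_inv
  have h16 : Ring.inverse (16 : ℤ_[p]) = h ^ 4 := by
    have h1 : (16 : ℤ_[p]) * h ^ 4 = 1 := by
      linear_combination (8 * h ^ 3 + 4 * h ^ 2 + 2 * h + 1) * hh
    rw [← one_mul (h ^ 4), ← Ring.inverse_mul_cancel (16 : ℤ_[p]) (IsUnit.of_mul_eq_one _ h1),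
      mul_assoc, h1, mul_one]
  have hsum : ∑ k ∈ range p, ((Nat.choose (2 * k) k : ℤ_[p]) ^ 2 *
      (-(Ring.inverse (16 : ℤ_[p]))) ^ k) =
      ∑ k ∈ range p, (-1) ^ k * ((k.centralBinom : ℤ_[p]) * (-h ^ 2) ^ k) ^ 2 :=
    sum_congr rfl fun k _ => by
      rw [h16, Nat.centralBinom, neg_pow, mul_pow, ← pow_mul (-h ^ 2), mul_comm k 2, pow_mul (-h ^ 2)]
      ring
  obtain ⟨T, hT⟩ := exists_teichmuller_mulChar p
  obtain ⟨a, b, hJ, hab, hb, hmod⟩ := exists_jacobiSum_teichmuller_eq hT hm hm0 hi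
  have hcong := sum_centralBinom_add_jacobiSum hT hm hm0 hh
  rw [hJ, ← sub_eq_add_neg] at hcong
  have hunitab : IsUnit ((a : ℤ_[p]) + b * i) := by
    have hS := isUnit_sum_centralBinom hm hh
    rw [isUnit_iff_toZMod_ne_zero] at hS ⊢
    have h0 := toZMod_eq_zero_iff_dvd.2 ((dvd_pow_self (p : ℤ_[p]) two_ne_zero).trans hcong)
    rw [map_sub, sub_eq_zero] at h0
    rwa [← h0]
  rw [hsum]
  convert hcong using 2
  obtain ⟨d, rfl⟩ := hv
  rcases eq_or_eq_neg_of_sq_add_sq hi (by omega) hab huv hb ⟨d, rfl⟩ hunitab hunit with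
    ⟨rfl, rfl⟩ | ⟨rfl, rfl⟩
  · rw [Even.neg_one_pow (Int.natAbs_even.2 (Int.even_iff.2 (by omega))), one_mul]
  · rw [Odd.neg_one_pow (Int.natAbs_odd.2 (Int.odd_iff.2 (by omega)))]
    push_cast
    ring
end

section
/- Let p > 3 be a prime with p \equiv 1 mod 3. Write p = u^2 + 3 v^2 with u, v integers, and choose the signs of u, v so that u + v\sqrt{-3} is a p-adic unit (for a fixed square root of -3 in Z_p). Then \sum_{k=0}^{p-1} g_k (-1/12)^k \equiv \chi_{-3}(u) (u + v\sqrt{-3}) mod p^2, where g_n = \sum_{k=0}^n (-8)^{n-k} \binom{n}{k} \sum_{j=0}^k \binom{k}{j}^3 and \chi_{-3} is the Legendre symbol mod 3. -/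
open Finset

/-- The twisted Zagier F sequence:
`g n = ∑_{k≤n} (-8)^{n-k} binom(n,k) ∑_{j≤k} binom(k,j)³`. -/
def zagierF (n : ℕ) : ℤ :=
  ∑ k ∈ Finset.range (n + 1),
    (-8) ^ (n - k) * (Nat.choose n k : ℤ) *
      ∑ j ∈ Finset.range (k + 1), (Nat.choose k j : ℤ) ^ 3

/-- `(3j)! / j!³`. -/
def trinom (j : ℕ) : ℕ := (3 * j).choose j * (2 * j).choose j

theorem trinom_mul_factorial (j : ℕ) : trinom j * (j.factorial) ^ 3 = (3 * j).factorial := by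
  have h1 := Nat.choose_mul_factorial_mul_factorial (show j ≤ 3 * j by lia)
  have h2 := Nat.choose_mul_factorial_mul_factorial (show j ≤ 2 * j by lia)
  rw [show 3 * j - j = 2 * j by lia] at h1
  rw [show 2 * j - j = j by lia] at h2
  rw [trinom, ← h1, ← h2]
  ring

section Franel

variable {K : Type*} [Field K] [CharZero K]

theorem choose_pred_cast (N j : ℕ) :
    (N.choose j : K) = ((N : K) + 1 - j) / (N + 1) * (N + 1).choose j := by
  have h0 : (N : K) + 1 ≠ 0 := by exact_mod_cast Nat.succ_ne_zero N
  have h := Nat.choose_mul_succ_eq N j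
  rcases le_or_gt j (N + 1) with hj | hj
  · have h' : (N.choose j : K) * (N + 1) = (N + 1).choose j * ((N : K) + 1 - j) := by
      rw [← Nat.cast_succ, ← Nat.cast_sub hj]
      exact_mod_cast h
    field_simp
    linear_combination h'
  · simp [Nat.choose_eq_zero_of_lt hj, Nat.choose_eq_zero_of_lt (show N < j by lia)]

theorem choose_succ_cast (N j : ℕ) :
    (N.choose (j + 1) : K) = ((N : K) - j) / (j + 1) * N.choose j := by
  have h0 : (j : K) + 1 ≠ 0 := by exact_mod_cast Nat.succ_ne_zero j
  have h := Nat.choose_succ_right_eq N j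
  rcases le_or_gt j N with hj | hj
  · have h' : (N.choose (j + 1) : K) * (j + 1) = N.choose j * ((N : K) - j) := by
      rw [← Nat.cast_sub hj]
      exact_mod_cast h
    field_simp
    linear_combination h'
  · simp [Nat.choose_eq_zero_of_lt hj, Nat.choose_eq_zero_of_lt (show N < j + 1 by lia)]

theorem trinom_succ_cast (j : ℕ) :
    (trinom (j + 1) : K) =
      3 * (3 * j + 1) * (3 * j + 2) / ((j : K) + 1) ^ 2 * trinom j := by
  have h0 : (j : K) + 1 ≠ 0 := by exact_mod_cast Nat.succ_ne_zero j
  have h1 : (j.factorial : K) ≠ 0 := by exact_mod_cast Nat.factorial_ne_zero j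
  have e : ∀ i, (trinom i : K) * (i.factorial : K) ^ 3 = (3 * i).factorial := fun i ↦ by
    exact_mod_cast trinom_mul_factorial i
  have ha := e j
  have hb := e (j + 1)
  rw [show 3 * (j + 1) = 3 * j + 1 + 1 + 1 by ring] at hb
  simp only [Nat.factorial_succ] at hb
  push_cast at hb
  rw [← ha] at hb
  field_simp
  have h3 : (j.factorial : K) ^ 3 * ((j : K) + 1) ≠ 0 := by positivity
  apply mul_right_cancel₀ h3
  linear_combination hb

/-- The recurrence of the Franel numbers. -/
theorem franel_recurrence (n : ℕ) :
    ((n : K) + 2) ^ 2 * ∑ j ∈ range (n + 3), ((n + 2).choose j : K) ^ 3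
      = (7 * n ^ 2 + 21 * n + 16) * ∑ j ∈ range (n + 2), ((n + 1).choose j : K) ^ 3
        + 8 * (n + 1) ^ 2 * ∑ j ∈ range (n + 1), (n.choose j : K) ^ 3 := by
  have h1 : (n : K) + 1 ≠ 0 := by exact_mod_cast Nat.succ_ne_zero n
  have h2 : (n : K) + 2 ≠ 0 := by exact_mod_cast Nat.succ_ne_zero (n + 1)
  have e1 : ∑ j ∈ range (n + 2), ((n + 1).choose j : K) ^ 3
      = ∑ j ∈ range (n + 3), ((n + 1).choose j : K) ^ 3 := by
    rw [sum_range_succ _ (n + 2), Nat.choose_eq_zero_of_lt (show n + 1 < n + 2 by lia)]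
    simp
  have e2 : ∑ j ∈ range (n + 1), (n.choose j : K) ^ 3
      = ∑ j ∈ range (n + 3), (n.choose j : K) ^ 3 := by
    rw [sum_range_succ _ (n + 2), sum_range_succ _ (n + 1),
      Nat.choose_eq_zero_of_lt (show n < n + 2 by lia),
      Nat.choose_eq_zero_of_lt (show n < n + 1 by lia)]
    simp
  let s : ℕ → K := fun j ↦ 4 * j ^ 3 - (18 * n + 30) * j ^ 2 + (27 * n ^ 2 + 93 * n + 78) * j
    - (14 * n ^ 3 + 74 * n ^ 2 + 128 * n + 72)
  let G : ℕ → K := fun j ↦ j ^ 3 * s j * ((n + 2).choose j : K) ^ 3 / ((n + 1) * (n + 2) ^ 3)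
  have key : ∀ j, ((n : K) + 2) ^ 2 * ((n + 2).choose j : K) ^ 3
      - (7 * n ^ 2 + 21 * n + 16) * ((n + 1).choose j : K) ^ 3
      - 8 * (n + 1) ^ 2 * (n.choose j : K) ^ 3 = G (j + 1) - G j := by
    intro j
    have h3 : (j : K) + 1 ≠ 0 := by exact_mod_cast Nat.succ_ne_zero j
    have a1 := choose_pred_cast (K := K) n j
    have a2 := choose_pred_cast (K := K) (n + 1) j
    have a3 := choose_succ_cast (K := K) (n + 2) j
    simp only [G, s]
    rw [a1, a3, a2]
    push_cast
    rw [show (n : K) + 1 + 1 = n + 2 by ring]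
    field_simp
    ring
  rw [e1, e2]
  have := sum_range_sub G (n + 3)
  rw [← sum_congr rfl fun j _ ↦ key j, sum_sub_distrib, sum_sub_distrib, ← mul_sum, ← mul_sum,
    ← mul_sum] at this
  have g0 : G (n + 3) - G 0 = 0 := by
    simp [G]
  rw [g0] at this
  linear_combination this

theorem trinom_choose_pred (N j : ℕ) :
    ((N + 2 * j).choose (3 * j) : K)
      = ((N : K) + 1 - j) / (N + 1 + 2 * j) * (N + 1 + 2 * j).choose (3 * j) := by
  have := choose_pred_cast (K := K) (N + 2 * j) (3 * j)
  rw [this, show N + 2 * j + 1 = N + 1 + 2 * j by ring]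
  push_cast
  congr 2 <;> ring

theorem trinom_choose_shift (N j : ℕ) :
    ((N + 2 * (j + 1)).choose (3 * (j + 1)) : K) * trinom (j + 1)
      = (N + 2 * j + 1) * (N + 2 * j + 2) * (N - j) / ((j : K) + 1) ^ 3
        * ((N + 2 * j).choose (3 * j) * trinom j) := by
  have h3 : (j : K) + 1 ≠ 0 := by exact_mod_cast Nat.succ_ne_zero j
  have h31 : 3 * (j : K) + 1 ≠ 0 := by exact_mod_cast Nat.succ_ne_zero (3 * j)
  have h32 : 3 * (j : K) + 2 ≠ 0 := by exact_mod_cast Nat.succ_ne_zero (3 * j + 1)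
  have b1 : ((N + 2 * j + 1).choose (3 * j + 1) : K)
      = (N + 2 * j + 1) / (3 * j + 1) * (N + 2 * j).choose (3 * j) := by
    have : ((N + 2 * j + 1 : ℕ) : K) * (N + 2 * j).choose (3 * j)
      = (N + 2 * j + 1).choose (3 * j + 1) * ((3 * j + 1 : ℕ) : K) := by
      exact_mod_cast Nat.add_one_mul_choose_eq (N + 2 * j) (3 * j)
    push_cast at this
    rw [div_mul_eq_mul_div, eq_div_iff h31]
    linear_combination -this
  have b2 : ((N + 2 * j + 1 + 1).choose (3 * j + 1 + 1) : K)
      = (N + 2 * j + 2) / (3 * j + 2) * (N + 2 * j + 1).choose (3 * j + 1) := by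
    have : ((N + 2 * j + 1 + 1 : ℕ) : K) * (N + 2 * j + 1).choose (3 * j + 1)
      = (N + 2 * j + 1 + 1).choose (3 * j + 1 + 1) * ((3 * j + 1 + 1 : ℕ) : K) := by
      exact_mod_cast Nat.add_one_mul_choose_eq (N + 2 * j + 1) (3 * j + 1)
    push_cast at this
    rw [div_mul_eq_mul_div, eq_div_iff h32]
    linear_combination -this
  have b3 := choose_succ_cast (K := K) (N + 2 * j + 1 + 1) (3 * j + 1 + 1)
  rw [show N + 2 * (j + 1) = N + 2 * j + 1 + 1 by ring,
    show 3 * (j + 1) = 3 * j + 1 + 1 + 1 by ring, b3, b2, b1, trinom_succ_cast]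
  push_cast
  rw [show 3 * (j : K) + 1 + 1 + 1 = 3 * (j + 1) by ring]
  generalize hd1 : 3 * (j : K) + 1 = d1 at *
  generalize hd2 : 3 * (j : K) + 2 = d2 at *
  field_simp
  rw [← hd1]
  ring

theorem trinom_sum_recurrence (q : ℕ → K)
    (hq : ∀ n, q n = ∑ j ∈ range (n + 1),
      (trinom j : K) * (-1 / 4) ^ j * (n + 2 * j).choose (3 * j)) (n : ℕ) :
    4 * ((n : K) + 2) ^ 2 * q (n + 2)
      + (7 * n ^ 2 + 21 * n + 16) * q (n + 1) - 2 * (n + 1) ^ 2 * q n = 0 := by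
  let t : ℕ → ℕ → K := fun n j ↦ (trinom j : K) * (-1 / 4) ^ j * (n + 2 * j).choose (3 * j)
  have ht : ∀ n j, n < j → t n j = 0 := fun n j h ↦ by
    simp [t, Nat.choose_eq_zero_of_lt (show n + 2 * j < 3 * j by lia)]
  have e1 : q (n + 1) = ∑ j ∈ range (n + 3), t (n + 1) j := by
    rw [sum_range_succ _ (n + 2), ht _ _ (by lia), hq]
    simp [t]
  have e2 : q n = ∑ j ∈ range (n + 3), t n j := by
    rw [sum_range_succ _ (n + 2), sum_range_succ _ (n + 1), ht _ _ (by lia), ht _ _ (by lia), hq]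
    simp [t]
  have e3 : q (n + 2) = ∑ j ∈ range (n + 3), t (n + 2) j := hq _
  let G : ℕ → K := fun j ↦ j ^ 3 * (-12 * (3 * n + 5)) * t (n + 2) j
    * ((n + 2) / ((n + 2 * j + 1) * (n + 2 * j + 2))) / (n + 2)
  have key : ∀ j, 4 * ((n : K) + 2) ^ 2 * t (n + 2) j
      + (7 * n ^ 2 + 21 * n + 16) * t (n + 1) j - 2 * (n + 1) ^ 2 * t n j = G (j + 1) - G j := by
    intro j
    have h2 : (n : K) + 2 ≠ 0 := by exact_mod_cast Nat.succ_ne_zero (n + 1)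
    have h3 : (j : K) + 1 ≠ 0 := by exact_mod_cast Nat.succ_ne_zero j
    have d1 : (n : K) + 1 + 2 * j ≠ 0 := by exact_mod_cast (by lia : n + 1 + 2 * j ≠ 0)
    have d2 : (n : K) + 2 + 2 * j ≠ 0 := by exact_mod_cast (by lia : n + 2 + 2 * j ≠ 0)
    have d3 : (n : K) + 3 + 2 * j ≠ 0 := by exact_mod_cast (by lia : n + 3 + 2 * j ≠ 0)
    have d4 : (n : K) + 4 + 2 * j ≠ 0 := by exact_mod_cast (by lia : n + 4 + 2 * j ≠ 0)
    have a1 := trinom_choose_pred (K := K) n j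
    have a2 := trinom_choose_pred (K := K) (n + 1) j
    have a3 := trinom_choose_shift (K := K) (n + 2) j
    have a4 : t (n + 2) (j + 1) = -1 / 4 * (-1 / 4) ^ j
        * (((n + 2 + 2 * (j + 1)).choose (3 * (j + 1)) : K) * trinom (j + 1)) := by
      simp only [t]; ring
    simp only [G]
    rw [a4, a3]
    simp only [t]
    rw [a1, a2]
    push_cast
    rw [show (n : K) + 1 + 1 + 2 * j = n + 2 + 2 * j by ring,
      show (n : K) + 2 * j + 1 = n + 1 + 2 * j by ring,
      show (n : K) + 2 * j + 2 = n + 2 + 2 * j by ring,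
      show (n : K) + 2 + 2 * j + 1 = n + 3 + 2 * j by ring,
      show (n : K) + 2 + 2 * j + 2 = n + 4 + 2 * j by ring,
      show (n : K) + 2 * (j + 1) + 1 = n + 3 + 2 * j by ring,
      show (n : K) + 2 * (j + 1) + 2 = n + 4 + 2 * j by ring]
    field_simp
    ring
  have := sum_range_sub G (n + 3)
  rw [← sum_congr rfl fun j _ ↦ key j, sum_sub_distrib, sum_add_distrib, ← mul_sum, ← mul_sum,
    ← mul_sum] at this
  have g0 : G (n + 3) - G 0 = 0 := by
    simp [G, ht (n + 2) (n + 3) (by lia)]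
  rw [g0] at this
  rw [e1, e2, e3]
  linear_combination this

theorem franel_eq_sum_trinom (n : ℕ) :
    (∑ j ∈ range (n + 1), (n.choose j : K) ^ 3) * (-1 / 4) ^ n
      = ∑ j ∈ range (n + 1), (trinom j : K) * (-1 / 4) ^ j * (n + 2 * j).choose (3 * j) := by
  induction n using Nat.twoStepInduction with
  | zero => simp [trinom]
  | one => norm_num [sum_range_succ, trinom, Nat.choose]
  | more n ih1 ih2 =>
    have h2 : (n : K) + 2 ≠ 0 := by exact_mod_cast Nat.succ_ne_zero (n + 1)
    have r1 := franel_recurrence (K := K) n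
    have r2 := trinom_sum_recurrence (K := K) _ (fun n ↦ rfl) n
    rw [← ih1, ← ih2] at r2
    have h4 : 4 * ((n : K) + 2) ^ 2 ≠ 0 := mul_ne_zero (by norm_num) (pow_ne_zero 2 h2)
    apply mul_left_cancel₀ h4
    linear_combination (1 / 4 * (-1 / 4) ^ n) * r1 - r2

end Franel

section Transforms

open Polynomial

variable {K : Type*} [Field K]

/-- Generating polynomial whose coefficients are the inverse binomial transform of `f_n (-1/4)^n`,
up to degree `N`. -/
noncomputable def franelPoly (K : Type*) [Field K] (N : ℕ) : K[X] :=
  ∑ j ∈ range N, C ((trinom j : K) * (-1 / 4) ^ j) * (X ^ j * (1 + X) ^ (2 * j))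

theorem coeff_X_pow_mul_one_add_X_pow (j a n : ℕ) :
    (X ^ j * (1 + X) ^ a : K[X]).coeff n = if j ≤ n then (a.choose (n - j) : K) else 0 := by
  rw [coeff_X_pow_mul']
  simp [coeff_one_add_X_pow]

/-- The functional `Q ↦ ∑_{n<p} [X^n] Q (r + X)^n`. -/
noncomputable def diagSum (p : ℕ) (r : K) : K[X] →ₗ[K] K :=
  ∑ e ∈ range p, (r ^ e * p.choose (e + 1)) • lcoeff K e

theorem diagSum_apply (p : ℕ) (r : K) (Q : K[X]) :
    diagSum p r Q = ∑ e ∈ range p, r ^ e * p.choose (e + 1) * Q.coeff e := by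
  simp [diagSum]

variable [CharZero K]

theorem franel_eq_coeff {n N : ℕ} (h : n < N) :
    (∑ j ∈ range (n + 1), (n.choose j : K) ^ 3) * (-1 / 4) ^ n
      = (franelPoly K N * (1 + X) ^ n).coeff n := by
  rw [franel_eq_sum_trinom, franelPoly, sum_mul, finsetSum_coeff]
  refine sum_subset_zero_on_sdiff (range_subset_range.2 h) (fun j hj ↦ ?_) (fun j hj ↦ ?_)
  · have : ¬ j ≤ n := by simp at hj; lia
    rw [mul_assoc, mul_assoc, ← pow_add, coeff_C_mul, coeff_X_pow_mul_one_add_X_pow, if_neg this,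
      mul_zero]
  · have : j ≤ n := by simp at hj; lia
    rw [mul_assoc (C _), mul_assoc (X ^ j), ← pow_add, coeff_C_mul, coeff_X_pow_mul_one_add_X_pow,
      if_pos this]
    congr 2
    rw [add_comm (2 * j) n]
    exact Nat.choose_symm_of_eq_add (by lia)

theorem zagierF_eq_coeff {n N : ℕ} (h : n < N) :
    (zagierF n : K) * (-1 / 12) ^ n = (franelPoly K N * (C (1 / 3) + X) ^ n).coeff n := by
  have e : (C (1 / 3) + X : K[X]) = C (1 / 3) * (1 + X) + C (2 / 3) * X := by
    have : (C (1 / 3) + C (2 / 3) : K[X]) = 1 := by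
      rw [← C_add]; norm_num
    linear_combination (-X : K[X]) * this
  rw [e, add_pow, mul_sum, finsetSum_coeff, zagierF]
  push_cast
  rw [sum_mul]
  refine sum_congr rfl fun k hk ↦ ?_
  have hk' : k ≤ n := by simp at hk; lia
  have e2 : franelPoly K N * ((C (1 / 3) * (1 + X)) ^ k * (C (2 / 3) * X) ^ (n - k)
        * (n.choose k : K[X]))
      = C ((1 / 3) ^ k * (2 / 3) ^ (n - k) * (n.choose k : K))
        * ((franelPoly K N * (1 + X) ^ k) * X ^ (n - k)) := by
    simp only [mul_pow, C_mul, C_pow, map_natCast]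
    ring
  rw [e2, coeff_C_mul, coeff_mul_X_pow', if_pos (by lia), show n - (n - k) = k by lia,
    ← franel_eq_coeff (by lia)]
  obtain ⟨d, rfl⟩ := Nat.exists_eq_add_of_le hk'
  simp only [Nat.add_sub_cancel_left]
  rw [pow_add (-1 / 12 : K), show (-1 / 12 : K) = (1 / 3) * (-1 / 4) by norm_num, mul_pow,
    mul_pow _ _ d, show (2 / 3 : K) = -8 * ((1 / 3) * (-1 / 4)) by norm_num, mul_pow, mul_pow _ _ d]
  ring

theorem sum_choose_range (p e : ℕ) : ∑ n ∈ range p, n.choose e = p.choose (e + 1) := by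
  induction p with
  | zero => simp
  | succ p ih => rw [sum_range_succ, ih, Nat.choose_succ_succ, add_comm]

theorem sum_coeff_mul_add_pow (p : ℕ) (r : K) (Q : K[X]) :
    ∑ n ∈ range p, (Q * (C r + X) ^ n).coeff n = diagSum p r Q := by
  have h : ∀ n ∈ range p, (Q * (C r + X) ^ n).coeff n
      = ∑ e ∈ range p, r ^ e * (n.choose e : K) * Q.coeff e := by
    intro n hn
    rw [coeff_mul, Nat.sum_antidiagonal_eq_sum_range_succ_mk]
    simp only [Nat.succ_eq_add_one]
    refine sum_subset_zero_on_sdiff (range_subset_range.2 (by simpa using hn))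
      (fun e he ↦ ?_) (fun e he ↦ ?_)
    · rw [Nat.choose_eq_zero_of_lt (by simp at he; lia)]; simp
    · have : e ≤ n := by simp at he; lia
      rw [add_comm (C r) X, coeff_X_add_C_pow, Nat.sub_sub_self this, Nat.choose_symm this]
      ring
  rw [sum_congr rfl h, sum_comm, diagSum_apply]
  refine sum_congr rfl fun e _ ↦ ?_
  rw [← sum_mul, ← mul_sum, ← sum_choose_range p e]
  push_cast
  rfl

theorem sum_zagierF_eq_diagSum (p : ℕ) :
    ∑ n ∈ range p, (zagierF n : K) * (-1 / 12) ^ n = diagSum p (1 / 3) (franelPoly K p) := by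
  rw [← sum_coeff_mul_add_pow]
  exact sum_congr rfl fun n hn ↦ zagierF_eq_coeff (by simpa using hn)

theorem diagSum_one_X_pow_mul (p j : ℕ) :
    diagSum p (1 : K) (X ^ j * (1 + X) ^ (2 * j)) = (p + 2 * j).choose (3 * j + 1) := by
  rw [← sum_coeff_mul_add_pow]
  have h : ∀ n ∈ range p, (X ^ j * (1 + X) ^ (2 * j) * (C (1 : K) + X) ^ n).coeff n
      = ((n + 2 * j).choose (3 * j) : K) := by
    intro n _
    rw [C_1, mul_assoc, ← pow_add, coeff_X_pow_mul_one_add_X_pow]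
    split_ifs with hj
    · rw [add_comm (2 * j) n]
      congr 1
      exact Nat.choose_symm_of_eq_add (by lia)
    · rw [Nat.choose_eq_zero_of_lt (by lia), Nat.cast_zero]
  rw [sum_congr rfl h]
  norm_cast
  induction p with
  | zero => simp [Nat.choose_eq_zero_of_lt (show 2 * j < 3 * j + 1 by lia)]
  | succ p ih =>
    rw [sum_range_succ, ih fun n hn ↦ h n (by simp at hn ⊢; lia),
      show p + 1 + 2 * j = p + 2 * j + 1 by ring, Nat.choose_succ_succ, add_comm]

theorem diagSum_one_franelPoly (p N : ℕ) :
    diagSum p (1 : K) (franelPoly K N)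
      = ∑ j ∈ range N, (trinom j : K) * (-1 / 4) ^ j * (p + 2 * j).choose (3 * j + 1) := by
  rw [franelPoly, map_sum]
  refine sum_congr rfl fun j _ ↦ ?_
  rw [← smul_eq_C_mul, map_smul, diagSum_one_X_pow_mul, smul_eq_mul]

end Transforms

section CubicChebyshev

open Polynomial

variable {K : Type*} [Field K]

/-- `3 ∫_{-1/3}^0 Q - ∫_{-1}^0 Q`. -/
noncomputable def intDefect (K : Type*) [Field K] : K[X] →ₗ[K] K :=
  Polynomial.lsum fun e ↦ ((-1) ^ e * ((1 / 3) ^ e - 1) / (e + 1) : K) • LinearMap.id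

theorem intDefect_apply (Q : K[X]) :
    intDefect K Q = Q.sum fun e a ↦ (-1) ^ e * ((1 / 3) ^ e - 1) / (e + 1) * a := by
  simp [intDefect, Polynomial.lsum_apply]

/-- `z³ - 3z` with `z = 3X + 2`, twice a rescaled cubic Chebyshev polynomial. -/
noncomputable def cheb (K : Type*) [Field K] : K[X] := (3 * X + 2) ^ 3 - 3 * (3 * X + 2)

theorem cheb_pow_recurrence (n : ℕ) :
    derivative (3 * ((n : K[X]) + 2) * cheb K ^ (n + 1)
        * ((4 - (3 * X + 2) ^ 2) * ((3 * X + 2) ^ 2 - 1)) + (3 * X + 2) * cheb K ^ (n + 2))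
      = 3 * (36 * (((n : K[X]) + 2) * ((n : K[X]) + 1) * cheb K ^ n)
          - (9 * ((n : K[X]) + 2) ^ 2 - 1) * cheb K ^ (n + 2)) := by
  have hz : derivative (3 * X + 2 : K[X]) = 3 := by simp [derivative_mul]
  have hd : cheb K = (3 * X + 2) ^ 3 - 3 * (3 * X + 2) := rfl
  generalize (3 * X + 2 : K[X]) = z at *
  have hz2 : derivative (z ^ 2) = 6 * z := by rw [sq, derivative_mul, hz]; ring
  have hc : derivative (cheb K) = 9 * (z ^ 2 - 1) := by
    rw [hd, pow_succ, derivative_sub, derivative_mul, derivative_mul, hz2, hz, derivative_ofNat]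
    ring
  have hp : ∀ m : ℕ, derivative (cheb K ^ (m + 1)) = (m + 1) * cheb K ^ m * (9 * (z ^ 2 - 1)) := by
    intro m
    rw [derivative_pow_succ, hc]
    simp
  simp only [derivative_add, derivative_mul, derivative_sub, hz, hz2, hp,
    derivative_ofNat, derivative_natCast, derivative_one]
  rw [pow_succ (cheb K) (n + 1), pow_succ (cheb K) n]
  generalize cheb K ^ n = P
  rw [hd]
  push_cast
  ring

variable [CharZero K]

theorem intDefect_derivative (Q : K[X]) :
    intDefect K (derivative Q) = 2 * Q.eval 0 - 3 * Q.eval (-1 / 3) + Q.eval (-1) := by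
  induction Q using Polynomial.induction_on' with
  | add P Q hP hQ => rw [derivative_add, map_add, hP, hQ]; simp only [eval_add]; ring
  | monomial n a =>
    rw [derivative_monomial, intDefect_apply, sum_monomial_index _ _ (by simp)]
    simp only [eval_monomial]
    cases n with
    | zero => simp; ring
    | succ n =>
      have : (n : K) + 1 ≠ 0 := by exact_mod_cast Nat.succ_ne_zero n
      rw [Nat.add_sub_cancel, show (-1 / 3 : K) = (-1) * (1 / 3) by norm_num, mul_pow]
      push_cast
      rw [zero_pow (Nat.succ_ne_zero n), pow_succ (-1 : K), pow_succ (1 / 3 : K)]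
      field_simp
      ring

theorem intDefect_cheb_pow (n : ℕ) : intDefect K (cheb K ^ (2 * n)) = 0 := by
  induction n with
  | zero =>
    have := intDefect_derivative (X : K[X])
    rw [derivative_X] at this
    rw [mul_zero, pow_zero, this]
    norm_num
  | succ n ih =>
    have h := congrArg (intDefect K) (cheb_pow_recurrence (K := K) (2 * n))
    rw [intDefect_derivative] at h
    have e : (3 * (36 * ((((2 * n : ℕ) : K[X]) + 2) * (((2 * n : ℕ) : K[X]) + 1) * cheb K ^ (2 * n))
          - (9 * (((2 * n : ℕ) : K[X]) + 2) ^ 2 - 1) * cheb K ^ (2 * n + 2)))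
        = (108 * ((2 * n + 2) * (2 * n + 1)) : K) • cheb K ^ (2 * n)
          - (3 * ((9 * (2 * n + 2) ^ 2 - 1)) : K) • cheb K ^ (2 * n + 2) := by
      simp only [smul_eq_C_mul, map_mul, map_sub, map_add, map_pow, map_natCast, map_ofNat, map_one]
      push_cast
      ring
    rw [e, map_sub, map_smul, map_smul, ih] at h
    have hne : (3 * ((9 * (2 * n + 2) ^ 2 - 1)) : K) ≠ 0 := by
      have : (3 * ((9 * (2 * n + 2) ^ 2 - 1)) : K) = ((108 * n ^ 2 + 216 * n + 105 : ℕ) : K) := by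
        push_cast; ring
      rw [this, Nat.cast_ne_zero]
      lia
    rw [show 2 * (n + 1) = 2 * n + 2 by ring]
    have hv0 : (cheb K).eval 0 = 2 := by simp [cheb]; norm_num
    have hv1 : (cheb K).eval (-1 / 3) = -2 := by simp [cheb]; norm_num
    have hv2 : (cheb K).eval (-1) = 2 := by simp [cheb]; norm_num
    generalize intDefect K (cheb K ^ (2 * n + 2)) = I at h ⊢
    simp only [eval_add, eval_mul, eval_sub, eval_pow, hv0, hv1, hv2, eval_ofNat, eval_X, eval_one,
      eval_natCast, smul_eq_mul, pow_succ _ (2 * n), pow_succ _ (2 * n + 1),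
      (even_two_mul n).neg_pow (2 : K)] at h
    push_cast at h
    have h' : (3 * ((9 * (2 * n + 2) ^ 2 - 1)) : K) * I = 0 := by
      linear_combination h
    exact (mul_eq_zero.1 h').resolve_left hne

theorem intDefect_comp_eq_zero {P : K[X]} (hP : P.comp (1 - X) = P) :
    intDefect K (P.comp (C (1 / 4) * (2 - cheb K))) = 0 := by
  obtain ⟨Q, hQ, hQP⟩ : ∃ Q : K[X], Q.comp (C (-1) * X) = Q ∧ P.comp (C (1 / 4) * (2 - cheb K))
      = Q.comp (cheb K) := by
    refine ⟨P.comp (C (1 / 4) * (2 - X)), ?_, ?_⟩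
    · conv_rhs => rw [← hP]
      rw [comp_assoc, comp_assoc]
      congr 1
      have : (C (1 / 4) : K[X]) * 4 = 1 := by
        rw [show (4 : K[X]) = C 4 from rfl, ← C_mul]; norm_num
      simp only [mul_comp, sub_comp, C_comp, X_comp, ofNat_comp, one_comp, map_neg, map_one]
      linear_combination this
    · rw [comp_assoc]; simp
  rw [hQP, comp_eq_sum_left, Polynomial.sum, map_sum]
  refine sum_eq_zero fun i _ ↦ ?_
  rw [← smul_eq_C_mul, map_smul, smul_eq_mul]
  rcases Nat.even_or_odd' i with ⟨c, rfl | rfl⟩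
  · rw [intDefect_cheb_pow, mul_zero]
  · have : Q.coeff (2 * c + 1) = 0 := by
      have h := congrArg (fun R : K[X] ↦ R.coeff (2 * c + 1)) hQ
      simp only [comp_C_mul_X_coeff] at h
      rw [Odd.neg_one_pow ⟨c, rfl⟩] at h
      have h2 : (2 : K) ≠ 0 := two_ne_zero
      apply (mul_eq_zero.1 (?_ : 2 * Q.coeff (2 * c + 1) = 0)).resolve_left h2
      linear_combination -h
    rw [this, zero_mul]

end CubicChebyshev

section PadicCongruence

variable {p : ℕ} [Fact p.Prime]

/-- Congruence of `p`-adic numbers modulo `p ^ n`. -/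
def PCong (n : ℕ) (x y : ℚ_[p]) : Prop := ∃ z ∈ PadicInt.subring p, x - y = (p : ℚ_[p]) ^ n * z

variable {n : ℕ} {x y z w : ℚ_[p]}

theorem natCast_prime_ne_zero : (p : ℚ_[p]) ≠ 0 :=
  Nat.cast_ne_zero.2 (Fact.out : p.Prime).ne_zero

namespace PCong

theorem refl (x : ℚ_[p]) : PCong n x x := ⟨0, zero_mem _, by simp⟩

theorem of_eq (h : x = y) : PCong n x y := h ▸ refl x

theorem symm (h : PCong n x y) : PCong n y x := by
  obtain ⟨a, ha, h⟩ := h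
  exact ⟨-a, neg_mem ha, by linear_combination -h⟩

theorem trans (h : PCong n x y) (h' : PCong n y z) : PCong n x z := by
  obtain ⟨a, ha, h⟩ := h
  obtain ⟨b, hb, h'⟩ := h'
  exact ⟨a + b, add_mem ha hb, by linear_combination h + h'⟩

theorem add (h : PCong n x y) (h' : PCong n z w) : PCong n (x + z) (y + w) := by
  obtain ⟨a, ha, h⟩ := h
  obtain ⟨b, hb, h'⟩ := h'
  exact ⟨a + b, add_mem ha hb, by linear_combination h + h'⟩

theorem sub (h : PCong n x y) (h' : PCong n z w) : PCong n (x - z) (y - w) := by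
  obtain ⟨a, ha, h⟩ := h
  obtain ⟨b, hb, h'⟩ := h'
  exact ⟨a - b, sub_mem ha hb, by linear_combination h - h'⟩

theorem mul_left (h : PCong n x y) (hz : z ∈ PadicInt.subring p) : PCong n (z * x) (z * y) := by
  obtain ⟨a, ha, h⟩ := h
  exact ⟨z * a, mul_mem hz ha, by linear_combination z * h⟩

theorem mul_right (h : PCong n x y) (hz : z ∈ PadicInt.subring p) : PCong n (x * z) (y * z) := by
  rw [mul_comm x, mul_comm y]
  exact h.mul_left hz

theorem sum {ι : Type*} {s : Finset ι} {f g : ι → ℚ_[p]} (h : ∀ i ∈ s, PCong n (f i) (g i)) :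
    PCong n (∑ i ∈ s, f i) (∑ i ∈ s, g i) := by
  classical
  induction s using Finset.induction_on with
  | empty => exact refl _
  | insert a s ha ih =>
    rw [sum_insert ha, sum_insert ha]
    exact (h a (mem_insert_self a s)).add (ih fun i hi ↦ h i (mem_insert_of_mem hi))

theorem prime_mul (h : PCong n x y) : PCong (n + 1) ((p : ℚ_[p]) * x) (p * y) := by
  obtain ⟨a, ha, h⟩ := h
  exact ⟨a, ha, by rw [← mul_sub, h]; ring⟩

theorem mem (h : PCong n x y) (hy : y ∈ PadicInt.subring p) : x ∈ PadicInt.subring p := by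
  obtain ⟨a, ha, h⟩ := h
  rw [show x = y + (p : ℚ_[p]) ^ n * a by linear_combination h]
  exact add_mem hy (mul_mem (pow_mem (natCast_mem _ p) n) ha)

theorem of_le {m : ℕ} (h : PCong n x y) (hm : m ≤ n) : PCong m x y := by
  obtain ⟨a, ha, h⟩ := h
  refine ⟨(p : ℚ_[p]) ^ (n - m) * a, mul_mem (pow_mem (natCast_mem _ p) _) ha, ?_⟩
  rw [← mul_assoc, ← pow_add, Nat.add_sub_cancel' hm, h]

theorem of_int {a b : ℤ} (h : (p : ℤ) ^ n ∣ a - b) : PCong n (a : ℚ_[p]) b := by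
  obtain ⟨c, hc⟩ := h
  refine ⟨c, intCast_mem _ c, ?_⟩
  exact_mod_cast congrArg (Int.cast (R := ℚ_[p])) hc

theorem of_zmod {a b : ℤ} (h : (a : ZMod p) = b) : PCong 1 (a : ℚ_[p]) b := by
  refine of_int ?_
  rw [pow_one, ← ZMod.intCast_zmod_eq_zero_iff_dvd]
  simp [h]

end PCong

theorem inv_natCast_mem {n : ℕ} (h : ¬ p ∣ n) : (n : ℚ_[p])⁻¹ ∈ PadicInt.subring p := by
  change ‖(n : ℚ_[p])⁻¹‖ ≤ 1
  rw [norm_inv]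
  have : ‖(n : ℚ_[p])‖ = 1 := by
    rw [Padic.norm_natCast_eq_one_iff]
    exact ((Fact.out : p.Prime).coprime_iff_not_dvd).2 h
  simp [this]

theorem inv_natCast_mem_of_lt {n : ℕ} (h0 : 0 < n) (h : n < p) :
    (n : ℚ_[p])⁻¹ ∈ PadicInt.subring p :=
  inv_natCast_mem fun hd ↦ absurd (Nat.le_of_dvd h0 hd) (by lia)

end PadicCongruence

section DiagSumShift

open Polynomial

variable {p : ℕ} [Fact p.Prime]

theorem choose_prime_pred (e : ℕ) (he : e < p) : ((p - 1).choose e : ZMod p) = (-1) ^ e := by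
  have hp : p.Prime := Fact.out
  induction e with
  | zero => simp
  | succ e ih =>
    have h1 : (((p - 1) + 1).choose (e + 1) : ZMod p) = 0 := by
      rw [Nat.sub_add_cancel hp.one_lt.le, ZMod.natCast_eq_zero_iff]
      exact hp.dvd_choose_self (by lia) he
    rw [Nat.choose_succ_succ, Nat.cast_add, ih (by lia)] at h1
    rw [pow_succ]
    linear_combination h1

theorem choose_prime_succ (hp2 : 2 < p) (e : ℕ) (he : e < p) :
    PCong 2 (p.choose (e + 1) : ℚ_[p]) (p * ((-1) ^ e / (e + 1))) := by
  have hp : p.Prime := Fact.out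
  have h0 : (e : ℚ_[p]) + 1 ≠ 0 := by exact_mod_cast Nat.succ_ne_zero e
  have key : (p.choose (e + 1) : ℚ_[p]) = p * (((p - 1).choose e : ℕ) : ℚ_[p]) / (e + 1) := by
    have := Nat.add_one_mul_choose_eq (p - 1) e
    rw [Nat.sub_add_cancel hp.one_lt.le] at this
    rw [eq_div_iff h0]
    exact_mod_cast this.symm
  rcases eq_or_ne (e + 1) p with h | h
  · refine PCong.of_eq ?_
    have he2 : Even e := by
      rcases hp.eq_two_or_odd' with h2 | h2
      · lia
      · rw [← h] at h2
        simpa using Nat.odd_add_one.1 h2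
    have h1 : (p : ℚ_[p]) = e + 1 := by exact_mod_cast congrArg (Nat.cast (R := ℚ_[p])) h.symm
    rw [show p.choose (e + 1) = 1 by rw [h, Nat.choose_self], he2.neg_one_pow, h1]
    field_simp
    simp
  · have h1 : PCong 1 (((p - 1).choose e : ℕ) : ℚ_[p]) ((-1) ^ e) := by
      have := PCong.of_zmod (p := p) (a := ((p - 1).choose e : ℕ)) (b := (-1) ^ e)
        (by push_cast; exact choose_prime_pred e he)
      simpa using this
    rw [key]
    have h2 := h1.prime_mul.mul_right (z := ((e : ℚ_[p]) + 1)⁻¹) (by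
      have := inv_natCast_mem_of_lt (p := p) (n := e + 1) (by lia) (by lia)
      simpa using this)
    convert h2 using 1 <;> ring

theorem one_third_mem (hp3 : 3 < p) : (1 / 3 : ℚ_[p]) ∈ PadicInt.subring p := by
  simpa using inv_natCast_mem_of_lt (p := p) (n := 3) (by lia) hp3

theorem pow_pred_cong {a : ℕ} (ha : ¬ p ∣ a) : PCong 1 ((a : ℚ_[p]) ^ (p - 1)) 1 := by
  have := PCong.of_zmod (p := p) (a := (a : ℤ) ^ (p - 1)) (b := 1) (by
    push_cast
    exact ZMod.pow_card_sub_one_eq_one fun h ↦ ha ((ZMod.natCast_eq_zero_iff _ _).1 h))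
  simpa using this

theorem diagSum_sub_apply (Q : ℚ_[p][X]) :
    diagSum p (1 / 3) Q - diagSum p 1 Q
      = ∑ e ∈ range p, ((1 / 3) ^ e - 1) * p.choose (e + 1) * Q.coeff e := by
  rw [diagSum_apply, diagSum_apply, ← sum_sub_distrib]
  refine sum_congr rfl fun e _ ↦ ?_
  rw [one_pow]
  ring

theorem diagSum_cong (hp3 : 3 < p) {Q : ℚ_[p][X]} (hQ : ∀ e, Q.coeff e ∈ PadicInt.subring p) :
    PCong 1 (diagSum p (1 / 3) Q - diagSum p 1 Q) 0 := by
  have hp : p.Prime := Fact.out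
  rw [diagSum_sub_apply, ← sum_const_zero (s := range p)]
  refine PCong.sum fun e he ↦ ?_
  have he : e < p := by simpa using he
  have hm : ((1 / 3 : ℚ_[p]) ^ e - 1) ∈ PadicInt.subring p :=
    sub_mem (pow_mem (one_third_mem hp3) e) (one_mem _)
  rcases eq_or_ne (e + 1) p with h | h
  · have h3 := pow_pred_cong (p := p) (a := 3) fun h ↦ by have := Nat.le_of_dvd (by lia) h; lia
    rw [show p - 1 = e by lia] at h3
    have h4 := ((PCong.refl (n := 1) 1).sub h3).mul_left (pow_mem (one_third_mem hp3) e)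
    have h5 := h4.mul_right (mul_mem (natCast_mem _ (p.choose (e + 1))) (hQ e))
    convert h5 using 1
    · rw [one_div, inv_pow, mul_sub]
      push_cast
      rw [inv_mul_cancel₀ (pow_ne_zero e (by norm_num : (3 : ℚ_[p]) ≠ 0))]
      ring
    · simp
  · have h1 : PCong 1 (((p.choose (e + 1) : ℕ) : ℤ) : ℚ_[p]) ((0 : ℤ) : ℚ_[p]) :=
      PCong.of_int (by
        rw [sub_zero, pow_one]
        exact_mod_cast hp.dvd_choose_self (by lia) (by lia))
    have h2 := (h1.mul_left hm).mul_right (hQ e)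
    simpa using h2

theorem diagSum_cong_sq (hp3 : 3 < p) {Q : ℚ_[p][X]} (hd : Q.natDegree < p)
    (hQ : ∀ e, Q.coeff e ∈ PadicInt.subring p) :
    PCong 2 (diagSum p (1 / 3) Q - diagSum p 1 Q) (p * intDefect ℚ_[p] Q) := by
  rw [diagSum_sub_apply, intDefect_apply, sum_over_range' _ (by simp) p hd, mul_sum]
  refine PCong.sum fun e he ↦ ?_
  have hm : ((1 / 3 : ℚ_[p]) ^ e - 1) ∈ PadicInt.subring p :=
    sub_mem (pow_mem (one_third_mem hp3) e) (one_mem _)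
  convert ((choose_prime_succ (by lia) e (by simpa using he)).mul_left hm).mul_right (hQ e) using 1
  ring

theorem coeff_shiftedLegendre_succ (k j : ℕ) :
    (j + 1) ^ 2 * (shiftedLegendre k).coeff (j + 1)
      = -((k - j) * (k + j + 1) * (shiftedLegendre k).coeff j) := by
  rw [coeff_shiftedLegendre, coeff_shiftedLegendre]
  have h1 : (k.choose (j + 1) : ℤ) * (j + 1) = k.choose j * (k - j) := by
    rcases le_or_gt j k with h | h
    · rw [← Nat.cast_sub h]
      exact_mod_cast Nat.choose_succ_right_eq k j
    · simp [Nat.choose_eq_zero_of_lt h, Nat.choose_eq_zero_of_lt (show k < j + 1 by lia)]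
  have h2 : ((k + (j + 1)).choose k : ℤ) * (j + 1) = (k + j + 1) * (k + j).choose k := by
    rw [Nat.choose_symm_add, Nat.choose_symm_add]
    exact_mod_cast (Nat.add_one_mul_choose_eq (k + j) j).symm
  rw [pow_succ]
  linear_combination ((-1) ^ j * (-1) * (k + (j + 1)).choose k * (j + 1)) * h1
    + ((-1) ^ j * (-1) * k.choose j * (k - j)) * h2

theorem trinom_zmod {k : ℕ} (hk : p = 3 * k + 1) {j : ℕ} (hj : j < p) :
    (trinom j : ZMod p) = 27 ^ j * (shiftedLegendre k).coeff j := by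
  induction j with
  | zero => simp [trinom, coeff_shiftedLegendre]
  | succ j ih =>
    have hj0 : ((j : ZMod p) + 1) ^ 2 ≠ 0 := by
      refine pow_ne_zero 2 fun h ↦ ?_
      rw [← Nat.cast_succ, ZMod.natCast_eq_zero_iff] at h
      have := Nat.le_of_dvd (by lia) h
      lia
    have h1 : ((j + 1) ^ 2 * trinom (j + 1) : ℕ) = 3 * (3 * j + 1) * (3 * j + 2) * trinom j := by
      have := trinom_succ_cast (K := ℚ) j
      have h0 : (j : ℚ) + 1 ≠ 0 := by exact_mod_cast Nat.succ_ne_zero j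
      field_simp at this
      rw [mul_comm]
      exact_mod_cast this
    have h1' := congrArg (Nat.cast (R := ZMod p)) h1
    have h2 := congrArg (Int.cast (R := ZMod p)) (coeff_shiftedLegendre_succ k j)
    have h3 : (3 * k + 1 : ZMod p) = 0 := by
      have := congrArg (Nat.cast (R := ZMod p)) hk
      rw [ZMod.natCast_self] at this
      exact_mod_cast this.symm
    push_cast at h1' h2
    have ih := ih (by lia)
    apply mul_left_cancel₀ hj0
    rw [h1', ih, pow_succ]
    linear_combination (-27 ^ j * 27) * h2
      + (27 ^ j * 3 * (3 * k + 2) * ((shiftedLegendre k).coeff j : ZMod p)) * h3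

end DiagSumShift

section DiagSumFranel

open Polynomial

variable {p : ℕ} [Fact p.Prime]

theorem PCong.mul_zero_zero {m n : ℕ} {x y : ℚ_[p]} (hx : PCong m x 0) (hy : PCong n y 0) :
    PCong (m + n) (x * y) 0 := by
  obtain ⟨a, ha, hx⟩ := hx
  obtain ⟨b, hb, hy⟩ := hy
  refine ⟨a * b, mul_mem ha hb, ?_⟩
  rw [sub_zero] at *
  rw [hx, hy]
  ring

theorem coeff_X_pow_mul_one_add_X_pow_mem (j a n : ℕ) :
    (X ^ j * (1 + X) ^ a : ℚ_[p][X]).coeff n ∈ PadicInt.subring p := by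
  rw [coeff_X_pow_mul_one_add_X_pow]
  split_ifs
  · exact natCast_mem _ _
  · exact zero_mem _

theorem shiftedLegendre_comp_cheb (K : Type*) [Field K] [CharZero K] {k N : ℕ} (hk : k < N) :
    ((shiftedLegendre k).map (Int.castRingHom K)).comp (C (1 / 4) * (2 - cheb K))
      = ∑ j ∈ range N, C (((27 ^ j * (shiftedLegendre k).coeff j : ℤ) : K) * (-1 / 4) ^ j)
          * (X ^ j * (1 + X) ^ (2 * j)) := by
  have h : C (1 / 4) * (2 - cheb K) = C (27 * (-1 / 4)) * (X * (1 + X) ^ 2) := by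
    rw [cheb, show (-1 / 4 : K) = -(1 / 4) by ring, C_mul, C_neg, C_ofNat]
    ring
  rw [comp_eq_sum_left, sum_over_range' _ (by simp) N
    (lt_of_le_of_lt natDegree_map_le (by simpa using hk))]
  refine sum_congr rfl fun j _ ↦ ?_
  rw [h, mul_pow, coeff_map, ← C_pow, ← mul_assoc, ← C_mul, mul_pow, mul_pow, ← pow_mul]
  congr 2
  push_cast
  simp
  ring

theorem diagSum_franelPoly_cong (hp3 : 3 < p) {k : ℕ} (hk : p = 3 * k + 1) :
    PCong 2 (diagSum p (1 / 3) (franelPoly ℚ_[p] p)) (diagSum p 1 (franelPoly ℚ_[p] p)) := by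
  have hp : p.Prime := Fact.out
  set D : ℚ_[p][X] →ₗ[ℚ_[p]] ℚ_[p] := diagSum p (1 / 3) - diagSum p 1 with hD
  have hDa : ∀ Q, diagSum p (1 / 3) Q - diagSum p 1 Q = D Q := fun Q ↦ rfl
  set P := (shiftedLegendre k).map (Int.castRingHom ℚ_[p])
  set L := P.comp (C (1 / 4) * (2 - cheb ℚ_[p])) with hL
  have hLs := shiftedLegendre_comp_cheb ℚ_[p] (show k < p by lia)
  rw [← hL] at hLs
  have hquarter : (-1 / 4 : ℚ_[p]) ∈ PadicInt.subring p := by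
    have := inv_natCast_mem (p := p) (n := 4) (fun h ↦ by
      have h2 : p ∣ 2 := hp.dvd_of_dvd_pow (show p ∣ 2 ^ 2 from h)
      have := Nat.le_of_dvd (by lia) h2
      lia)
    rw [show (-1 / 4 : ℚ_[p]) = -((4 : ℕ) : ℚ_[p])⁻¹ by push_cast; ring]
    exact neg_mem this
  have hLD : PCong 2 (D L) 0 := by
    have hdeg : L.natDegree < p := by
      have h1 : P.natDegree ≤ k := natDegree_map_le.trans (by simp)
      have h2 : (C (1 / 4) * (2 - cheb ℚ_[p])).natDegree ≤ 3 := by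
        unfold cheb
        compute_degree
      exact natDegree_comp_le.trans_lt ((Nat.mul_le_mul h1 h2).trans_lt (by lia))
    have hc : ∀ e, L.coeff e ∈ PadicInt.subring p := fun e ↦ by
      rw [hLs, finsetSum_coeff]
      refine sum_mem fun j _ ↦ ?_
      rw [coeff_C_mul]
      exact mul_mem (mul_mem (intCast_mem _ _) (pow_mem hquarter j))
        (coeff_X_pow_mul_one_add_X_pow_mem _ _ _)
    have h := diagSum_cong_sq hp3 hdeg hc
    have hP : P.comp (1 - X) = P := by
      have := congrArg (map (Int.castRingHom ℚ_[p]))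
        (neg_one_pow_mul_shiftedLegendre_comp_one_sub_X_eq k)
      have hk2 : Even k := by
        rcases hp.eq_two_or_odd' with h2 | h2
        · lia
        · rw [hk] at h2
          by_contra hk2
          rw [Nat.not_even_iff_odd] at hk2
          obtain ⟨a, rfl⟩ := hk2
          obtain ⟨b, hb⟩ := h2
          lia
      rw [hk2.neg_one_pow, one_mul, map_comp] at this
      simpa using this
    rwa [hL, intDefect_comp_eq_zero hP, mul_zero, hDa] at h
  have hdiff : PCong 2 (D (franelPoly ℚ_[p] p) - D L) 0 := by
    rw [hLs, franelPoly, map_sum, map_sum, ← sum_sub_distrib, ← sum_const_zero (s := range p)]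
    refine PCong.sum fun j hj ↦ ?_
    have h1 := diagSum_cong hp3 (coeff_X_pow_mul_one_add_X_pow_mem (p := p) j (2 * j))
    have h2 := PCong.of_zmod (p := p) (a := trinom j) (b := 27 ^ j * (shiftedLegendre k).coeff j)
      (by push_cast; exact trinom_zmod hk (by simpa using hj))
    have h3 := (h2.sub (PCong.refl (((27 ^ j * (shiftedLegendre k).coeff j : ℤ)) : ℚ_[p])))
    rw [sub_self] at h3
    have h4 := (h3.mul_zero_zero h1).mul_left (pow_mem hquarter j)
    rw [← smul_eq_C_mul, ← smul_eq_C_mul, map_smul, map_smul, ← hDa]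
    convert h4 using 1
    · simp only [smul_eq_mul, Int.cast_natCast]
      ring
    · rw [mul_zero]
  have := hdiff.add hLD
  rw [sub_add_cancel, add_zero, ← hDa] at this
  simpa using this.add (PCong.refl (diagSum p 1 (franelPoly ℚ_[p] p)))

end DiagSumFranel

section Harmonic

variable {p : ℕ} [Fact p.Prime]

theorem inv_add_one_mem {i : ℕ} (h : i + 1 < p) :
    1 / ((i : ℚ_[p]) + 1) ∈ PadicInt.subring p := by
  simpa using inv_natCast_mem_of_lt (p := p) (Nat.succ_pos i) h

theorem inv_odd_mem {i : ℕ} (h : 2 * i + 1 < p) :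
    1 / (2 * (i : ℚ_[p]) + 1) ∈ PadicInt.subring p := by
  simpa using inv_natCast_mem_of_lt (p := p) (Nat.succ_pos (2 * i)) h

/-- The harmonic numbers in `ℚ_[p]`. -/
noncomputable def pharm (p : ℕ) [Fact p.Prime] (n : ℕ) : ℚ_[p] :=
  ∑ i ∈ range n, 1 / ((i : ℚ_[p]) + 1)

theorem pharm_succ (n : ℕ) : pharm p (n + 1) = pharm p n + 1 / ((n : ℚ_[p]) + 1) :=
  sum_range_succ _ n

theorem pharm_mem {n : ℕ} (h : n < p) : pharm p n ∈ PadicInt.subring p :=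
  sum_mem fun i hi ↦ inv_add_one_mem (by simp at hi; lia)

/-- Sums of reciprocals of odd numbers. -/
noncomputable def oddHarm (p : ℕ) [Fact p.Prime] (n : ℕ) : ℚ_[p] :=
  ∑ i ∈ range n, 1 / (2 * (i : ℚ_[p]) + 1)

theorem oddHarm_mem {n : ℕ} (h : 2 * n ≤ p) : oddHarm p n ∈ PadicInt.subring p :=
  sum_mem fun i hi ↦ inv_odd_mem (by simp at hi; lia)

theorem pharm_two_mul (n : ℕ) : pharm p (2 * n) = 1 / 2 * pharm p n + oddHarm p n := by
  induction n with
  | zero => simp [pharm, oddHarm]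
  | succ n ih =>
    have h1 : (n : ℚ_[p]) + 1 ≠ 0 := by exact_mod_cast Nat.succ_ne_zero n
    have h2 : 2 * (n : ℚ_[p]) + 1 ≠ 0 := by exact_mod_cast Nat.succ_ne_zero (2 * n)
    rw [oddHarm, sum_range_succ, ← oddHarm, show 2 * (n + 1) = 2 * n + 1 + 1 by ring, pharm_succ,
      pharm_succ, pharm_succ, ih]
    push_cast
    rw [show 2 * (n : ℚ_[p]) + 1 + 1 = 2 * (n + 1) by ring]
    field_simp
    ring

theorem half_mem (hp2 : 2 < p) : (1 / 2 : ℚ_[p]) ∈ PadicInt.subring p := by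
  simpa using inv_natCast_mem_of_lt (p := p) (n := 2) (by lia) hp2

theorem oddHarm_cong {m n : ℕ} (hm : p = 2 * m + 1) (hn : n ≤ m) (hm0 : 0 < m) :
    PCong 1 (oddHarm p n) (1 / 2 * pharm p (m - n) - 1 / 2 * pharm p m) := by
  induction n with
  | zero => exact PCong.of_eq (by simp [oddHarm])
  | succ n ih =>
    rw [oddHarm, sum_range_succ, ← oddHarm]
    have h := ih (by lia)
    rw [show m - n = (m - (n + 1)) + 1 by lia, pharm_succ] at h
    set d := m - (n + 1) with hd
    have hpd : (p : ℚ_[p]) = 2 * (d + 1) + (2 * n + 1) := by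
      exact_mod_cast congrArg (Nat.cast (R := ℚ_[p])) (show p = 2 * (d + 1) + (2 * n + 1) by lia)
    have h1 : (d : ℚ_[p]) + 1 ≠ 0 := by exact_mod_cast Nat.succ_ne_zero d
    have h2 : 2 * (n : ℚ_[p]) + 1 ≠ 0 := by exact_mod_cast Nat.succ_ne_zero (2 * n)
    have h3 : PCong 1 (1 / (2 * (n : ℚ_[p]) + 1)) (-(1 / 2 * (1 / ((d : ℚ_[p]) + 1)))) := by
      refine ⟨1 / (2 * (n : ℚ_[p]) + 1) * (1 / 2 * (1 / ((d : ℚ_[p]) + 1))),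
        mul_mem (inv_odd_mem (by lia)) (mul_mem (half_mem (by lia)) (inv_add_one_mem (by lia))), ?_⟩
      rw [hpd]
      field_simp
      ring
    convert h.add h3 using 1
    ring

end Harmonic

section OneUnits

variable {p : ℕ} [Fact p.Prime]

theorem PCong.one_add_mul {x y a b : ℚ_[p]} (ha : a ∈ PadicInt.subring p)
    (hb : b ∈ PadicInt.subring p) (hx : PCong 2 x (1 + p * a)) (hy : PCong 2 y (1 + p * b)) :
    PCong 2 (x * y) (1 + p * (a + b)) := by
  have hp : (p : ℚ_[p]) ∈ PadicInt.subring p := natCast_mem _ p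
  have hym : y ∈ PadicInt.subring p := hy.mem (add_mem (one_mem _) (mul_mem hp hb))
  refine (hx.mul_right hym).trans ((hy.mul_left (add_mem (one_mem _) (mul_mem hp ha))).trans ?_)
  exact ⟨a * b, mul_mem ha hb, by ring⟩

theorem PCong.prod_one_add {ι : Type*} {s : Finset ι} {f a : ι → ℚ_[p]}
    (ha : ∀ i ∈ s, a i ∈ PadicInt.subring p) (hf : ∀ i ∈ s, PCong 2 (f i) (1 + p * a i)) :
    PCong 2 (∏ i ∈ s, f i) (1 + p * ∑ i ∈ s, a i) := by
  classical
  induction s using Finset.induction_on with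
  | empty => exact PCong.of_eq (by simp)
  | insert i s hi ih =>
    rw [prod_insert hi, sum_insert hi]
    have ha' : ∀ j ∈ s, a j ∈ PadicInt.subring p := fun j hj ↦ ha j (mem_insert_of_mem hj)
    exact PCong.one_add_mul (ha i (mem_insert_self i s)) (sum_mem ha') (hf i (mem_insert_self i s))
      (ih ha' fun j hj ↦ hf j (mem_insert_of_mem hj))

theorem PCong.div_one_add {u x y a b c : ℚ_[p]} (hu : u ∈ PadicInt.subring p)
    (hc : c ∈ PadicInt.subring p)
    (ha : a ∈ PadicInt.subring p) (hb : b ∈ PadicInt.subring p) (hx : PCong 2 x (1 + p * a))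
    (hy : PCong 2 y (1 + p * b)) (h : u * x = c * y) :
    PCong 2 u (c * (1 + p * (b - a))) := by
  have h1 : PCong 2 (1 - (p : ℚ_[p]) * a) (1 + (p : ℚ_[p]) * -a) := PCong.of_eq (by ring)
  have h2 := (PCong.one_add_mul ha (neg_mem ha) hx h1).mul_left hu
  have h3 := (PCong.one_add_mul hb (neg_mem ha) hy h1).mul_left hc
  rw [← mul_assoc, add_neg_cancel, mul_zero, add_zero, mul_one, h, mul_assoc] at h2
  rw [sub_eq_add_neg]
  exact h2.symm.trans h3

end OneUnits

section FranelSum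

variable {p : ℕ} [Fact p.Prime]

/-- The quotient by `p / (3j+1)` of `(3j)! / j!³ (-1/4)^j binom(p+2j, 3j+1)`. -/
noncomputable def franelTerm (p : ℕ) [Fact p.Prime] (j : ℕ) : ℚ_[p] :=
  (-1 / 4) ^ j * ((p + 2 * j).choose (3 * j) * trinom j) * (p - j) / p

theorem mul_franelTerm (j : ℕ) :
    (trinom j : ℚ_[p]) * (-1 / 4) ^ j * (p + 2 * j).choose (3 * j + 1)
      = p / (3 * j + 1) * franelTerm p j := by
  have hp := natCast_prime_ne_zero (p := p)
  have h := choose_succ_cast (K := ℚ_[p]) (p + 2 * j) (3 * j)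
  push_cast at h
  rw [h, franelTerm]
  field_simp
  ring

theorem franelTerm_zero : franelTerm p 0 = 1 := by
  simp [franelTerm, trinom]

theorem franelTerm_succ (j : ℕ) :
    franelTerm p (j + 1) = -1 / 4 * ((p + 2 * j + 1) * (p + 2 * j + 2) * (p - j - 1)
      / ((j : ℚ_[p]) + 1) ^ 3) * franelTerm p j := by
  rw [franelTerm, trinom_choose_shift, franelTerm]
  push_cast
  ring

theorem neg_quarter_mem (hp2 : 2 < p) : (-1 / 4 : ℚ_[p]) ∈ PadicInt.subring p := by
  have h := half_mem hp2
  rw [show (-1 / 4 : ℚ_[p]) = -(1 / 2 * (1 / 2)) by norm_num]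
  exact neg_mem (mul_mem h h)

theorem franelTerm_ratio_mem (hp2 : 2 < p) {j : ℕ} (hj : j + 1 < p) :
    -1 / 4 * ((p + 2 * j + 1) * (p + 2 * j + 2) * (p - j - 1) / ((j : ℚ_[p]) + 1) ^ 3)
      ∈ PadicInt.subring p := by
  have h1 := inv_add_one_mem hj
  rw [show -1 / 4 * ((p + 2 * j + 1) * (p + 2 * j + 2) * (p - j - 1) / ((j : ℚ_[p]) + 1) ^ 3)
    = -1 / 4 * (((p + 2 * j + 1) * (p + 2 * j + 2) * (p - (j + 1)))
      * (1 / ((j : ℚ_[p]) + 1)) ^ 3) by rw [one_div_pow]; ring]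
  refine mul_mem (neg_quarter_mem hp2) (mul_mem ?_ (pow_mem h1 3))
  have : (((p + 2 * j + 1) * (p + 2 * j + 2) * (p - (j + 1)) : ℤ) : ℚ_[p])
    ∈ PadicInt.subring p := intCast_mem _ _
  simpa using this

theorem franelTerm_mem (hp2 : 2 < p) {j : ℕ} (hj : j < p) :
    franelTerm p j ∈ PadicInt.subring p := by
  induction j with
  | zero => rw [franelTerm_zero]; exact one_mem _
  | succ j ih =>
    rw [franelTerm_succ]
    exact mul_mem (franelTerm_ratio_mem hp2 hj) (ih (by lia))

theorem franelTerm_cong_zero (hp2 : 2 < p) {m j : ℕ} (hm : p = 2 * m + 1) (hmj : m < j)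
    (hj : j < p) : PCong 1 (franelTerm p j) 0 := by
  induction j, hmj using Nat.le_induction with
  | base =>
    have hpd : (p : ℚ_[p]) = 2 * m + 1 := by
      exact_mod_cast congrArg (Nat.cast (R := ℚ_[p])) hm
    have h1 := franelTerm_mem hp2 (show m < p by lia)
    rw [franelTerm_succ]
    have h2 := inv_add_one_mem (p := p) (i := m) (by lia)
    refine ⟨-1 / 4 * (2 * ((2 * p + 1) * (p - (m + 1))) * (1 / ((m : ℚ_[p]) + 1)) ^ 3)
      * franelTerm p m, mul_mem (mul_mem (neg_quarter_mem hp2) (mul_mem ?_ (pow_mem h2 3))) h1, ?_⟩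
    · have : ((2 * ((2 * p + 1) * (p - (m + 1))) : ℤ) : ℚ_[p]) ∈ PadicInt.subring p :=
        intCast_mem _ _
      simpa using this
    · rw [show (p : ℚ_[p]) + 2 * m + 1 = 2 * p by rw [hpd]; ring,
        show (p : ℚ_[p]) + 2 * m + 2 = 2 * p + 1 by rw [hpd]; ring, one_div_pow]
      ring
  | succ j hmj ih =>
    rw [franelTerm_succ]
    simpa using (ih (by lia)).mul_left (franelTerm_ratio_mem hp2 hj)

theorem franelTerm_mul_prod {m : ℕ} (hm : p = 2 * m + 1) (j : ℕ) :
    franelTerm p j * ∏ i ∈ range j, (1 - p * (1 / (2 * (i : ℚ_[p]) + 1)))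
      = (-1) ^ j * m.choose j * ∏ i ∈ range j, ((1 + p * (1 / (2 * (i : ℚ_[p]) + 1)))
        * (1 + p * (1 / 2 * (1 / ((i : ℚ_[p]) + 1)))) * (1 - p * (1 / ((i : ℚ_[p]) + 1)))) := by
  induction j with
  | zero => simp [franelTerm_zero]
  | succ j ih =>
    have h1 : (j : ℚ_[p]) + 1 ≠ 0 := by exact_mod_cast Nat.succ_ne_zero j
    have h2 : 2 * (j : ℚ_[p]) + 1 ≠ 0 := by exact_mod_cast Nat.succ_ne_zero (2 * j)
    have hpd : (p : ℚ_[p]) = 2 * m + 1 := by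
      exact_mod_cast congrArg (Nat.cast (R := ℚ_[p])) hm
    have hc := choose_succ_cast (K := ℚ_[p]) m j
    rw [show (m : ℚ_[p]) = (p - 1) / 2 by rw [hpd]; ring] at hc
    rw [prod_range_succ, prod_range_succ, franelTerm_succ, hc]
    set A := ∏ i ∈ range j, (1 - p * (1 / (2 * (i : ℚ_[p]) + 1)))
    set B := ∏ i ∈ range j, ((1 + p * (1 / (2 * (i : ℚ_[p]) + 1)))
        * (1 + p * (1 / 2 * (1 / ((i : ℚ_[p]) + 1)))) * (1 - p * (1 / ((i : ℚ_[p]) + 1))))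
    have e1 : -1 / 4 * ((p + 2 * j + 1) * (p + 2 * j + 2) * (p - j - 1) / ((j : ℚ_[p]) + 1) ^ 3)
        * franelTerm p j * (A * (1 - p * (1 / (2 * (j : ℚ_[p]) + 1))))
      = -1 / 4 * ((p + 2 * j + 1) * (p + 2 * j + 2) * (p - j - 1) / ((j : ℚ_[p]) + 1) ^ 3)
        * (1 - p * (1 / (2 * (j : ℚ_[p]) + 1))) * (franelTerm p j * A) := by ring
    rw [e1, ih]
    field_simp
    ring

theorem franelTerm_cong {m : ℕ} (hm : p = 2 * m + 1) (hm0 : 0 < m) {j : ℕ} (hj : j ≤ m) :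
    PCong 2 (franelTerm p j) ((-1) ^ j * m.choose j
      * (1 + p * (2 * oddHarm p j - 1 / 2 * pharm p j))) := by
  have hh := half_mem (p := p) (by lia)
  have ho : ∀ i ∈ range j, 1 / (2 * (i : ℚ_[p]) + 1) ∈ PadicInt.subring p := fun i hi ↦
    inv_odd_mem (by simp at hi; lia)
  have hi : ∀ i ∈ range j, 1 / ((i : ℚ_[p]) + 1) ∈ PadicInt.subring p := fun i hi ↦
    inv_add_one_mem (by simp at hi; lia)
  have hx := PCong.prod_one_add (s := range j) (a := fun i ↦ -(1 / (2 * (i : ℚ_[p]) + 1)))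
    (f := fun i ↦ 1 - (p : ℚ_[p]) * (1 / (2 * (i : ℚ_[p]) + 1)))
    (fun i hi ↦ neg_mem (ho i hi)) fun i hi ↦ PCong.of_eq (by ring)
  have hy := PCong.prod_one_add (s := range j) (a := fun i ↦ 1 / (2 * (i : ℚ_[p]) + 1)
      + 1 / 2 * (1 / ((i : ℚ_[p]) + 1)) + -(1 / ((i : ℚ_[p]) + 1)))
    (f := fun i ↦ (1 + (p : ℚ_[p]) * (1 / (2 * (i : ℚ_[p]) + 1)))
        * (1 + (p : ℚ_[p]) * (1 / 2 * (1 / ((i : ℚ_[p]) + 1))))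
        * (1 - (p : ℚ_[p]) * (1 / ((i : ℚ_[p]) + 1))))
    (fun i h ↦ add_mem (add_mem (ho i h) (mul_mem hh (hi i h))) (neg_mem (hi i h)))
    fun i h ↦ PCong.one_add_mul (add_mem (ho i h) (mul_mem hh (hi i h))) (neg_mem (hi i h))
      (PCong.one_add_mul (ho i h) (mul_mem hh (hi i h)) (PCong.refl _) (PCong.refl _))
      (PCong.of_eq (by ring))
  rw [sum_neg_distrib, ← oddHarm] at hx
  rw [sum_add_distrib, sum_add_distrib, sum_neg_distrib, ← mul_sum, ← oddHarm, ← pharm] at hy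
  have hom := oddHarm_mem (p := p) (n := j) (by lia)
  have him := pharm_mem (p := p) (n := j) (by lia)
  have hc : ((-1) ^ j * m.choose j : ℚ_[p]) ∈ PadicInt.subring p :=
    mul_mem (pow_mem (neg_mem (one_mem _)) j) (natCast_mem _ _)
  have := PCong.div_one_add (franelTerm_mem (by lia) (by lia)) hc (neg_mem hom)
    (add_mem (add_mem hom (mul_mem hh him)) (neg_mem him)) hx hy (franelTerm_mul_prod hm j)
  convert this using 3
  ring

end FranelSum

section BetaSum

variable {K : Type*} [Field K]

theorem sum_alternating_choose_div (d : K) (m : ℕ) (a : K) (ha : ∀ j : ℕ, a + d * j ≠ 0) :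
    (∑ j ∈ range (m + 1), (-1) ^ j * (m.choose j : K) / (a + d * j))
      * ∏ i ∈ range (m + 1), (a + d * i) = d ^ m * m.factorial := by
  induction m generalizing a with
  | zero => simpa using inv_mul_cancel₀ (by simpa using ha 0)
  | succ m ih =>
    have ha' : ∀ j : ℕ, a + d + d * j ≠ 0 := fun j ↦ by
      have := ha (j + 1)
      push_cast at this
      rwa [show a + d + d * j = a + d * (j + 1) by ring]
    have h1 := ih a ha
    have h2 := ih (a + d) ha'
    have hs : ∑ j ∈ range (m + 1 + 1), (-1) ^ j * ((m + 1).choose j : K) / (a + d * j)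
        = ∑ j ∈ range (m + 1), (-1) ^ j * (m.choose j : K) / (a + d * j)
          - ∑ j ∈ range (m + 1), (-1) ^ j * (m.choose j : K) / (a + d + d * j) := by
      have e1 : ∑ j ∈ range (m + 1), (-1) ^ j * (m.choose j : K) / (a + d * j)
          = ∑ j ∈ range (m + 1 + 1), (-1) ^ j * (m.choose j : K) / (a + d * j) := by
        rw [sum_range_succ _ (m + 1)]
        simp
      rw [e1, sum_range_succ', sum_range_succ' _ (m + 1), add_sub_right_comm, ← sum_sub_distrib]
      congr 1
      · refine sum_congr rfl fun j _ ↦ ?_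
        rw [Nat.choose_succ_succ]
        push_cast
        rw [show a + d + d * j = a + d * (j + 1) by ring]
        ring
      · simp
    have hp1 : ∏ i ∈ range (m + 1 + 1), (a + d * i)
        = (∏ i ∈ range (m + 1), (a + d * i)) * (a + d * (m + 1 : ℕ)) := prod_range_succ _ _
    have hp2 : ∏ i ∈ range (m + 1 + 1), (a + d * i)
        = (∏ i ∈ range (m + 1), (a + d + d * i)) * a := by
      rw [prod_range_succ']
      push_cast
      congr 1
      · exact prod_congr rfl fun i _ ↦ by ring
      · ring
    rw [hs, sub_mul]
    nth_rewrite 1 [hp1]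
    rw [hp2, ← mul_assoc, ← mul_assoc, h1, h2, Nat.factorial_succ]
    push_cast
    ring

end BetaSum

section FranelSum

variable {p : ℕ} [Fact p.Prime]

theorem prod_three_mul_succ (n : ℕ) :
    ∏ i ∈ range n, (3 * ((i : ℚ_[p]) + 1)) = 3 ^ n * n.factorial := by
  rw [prod_mul_distrib, prod_const, card_range, ← prod_range_add_one_eq_factorial]
  push_cast
  rfl

theorem prod_three_mul_add_one {e : ℕ} (he : p = 6 * e + 1) :
    ∏ i ∈ range (3 * e + 1), (1 + 3 * (i : ℚ_[p]))
      = (3 ^ (2 * e) * (2 * e).factorial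
          * ∏ i ∈ range (2 * e), (1 - p * (1 / 3 * (1 / ((i : ℚ_[p]) + 1)))))
        * p * (3 ^ e * e.factorial
          * ∏ i ∈ range e, (1 + p * (1 / 3 * (1 / ((i : ℚ_[p]) + 1))))) := by
  have hpe : (p : ℚ_[p]) = 6 * e + 1 := by
    exact_mod_cast congrArg (Nat.cast (R := ℚ_[p])) he
  have hi : ∀ i : ℕ, (i : ℚ_[p]) + 1 ≠ 0 := fun i ↦ by exact_mod_cast Nat.succ_ne_zero i
  rw [show 3 * e + 1 = 2 * e + 1 + e by ring, prod_range_add, prod_range_succ,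
    ← prod_three_mul_succ, ← prod_three_mul_succ, ← prod_mul_distrib, ← prod_mul_distrib]
  congr 1
  · congr 1
    · rw [← prod_range_reflect]
      have h1 (f : ℕ → ℚ_[p]) : ∏ i ∈ range (2 * e), f i = ∏ i ∈ range (2 * e), -f i := by
        rw [prod_neg]
        simp
      rw [h1]
      refine prod_congr rfl fun i hi' ↦ ?_
      have hcast : ((2 * e - 1 - i : ℕ) : ℚ_[p]) = 2 * e - 1 - i := by
        have hlt : i < 2 * e := by simpa using hi'
        rw [Nat.cast_sub (by lia), Nat.cast_sub (by lia)]
        push_cast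
        rfl
      have := hi i
      rw [hcast, hpe]
      field_simp
      ring
    · rw [hpe]; push_cast; ring
  · refine prod_congr rfl fun i _ ↦ ?_
    have := hi i
    rw [hpe]
    push_cast
    field_simp
    ring

/-- The common value modulo `p²` of the sum of Franel numbers and of the Jacobi sum, in terms of
harmonic numbers. -/
noncomputable def harmValue (p : ℕ) [Fact p.Prime] (e : ℕ) : ℚ_[p] :=
  (3 * e).choose e * (1 + p * (1 / 2 * (1 / 3 * pharm p e + 2 / 3 * pharm p (2 * e)
    - pharm p (3 * e))))

theorem one_third_mul_inv_mem (hp3 : 3 < p) {i : ℕ} (h : i + 1 < p) :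
    1 / 3 * (1 / ((i : ℚ_[p]) + 1)) ∈ PadicInt.subring p :=
  mul_mem (one_third_mem hp3) (inv_add_one_mem h)

theorem prime_mul_inv_mem {e : ℕ} (he : p = 6 * e + 1) {j : ℕ} (hj : j < p) (hje : j ≠ 2 * e) :
    1 / (3 * (j : ℚ_[p]) + 1) ∈ PadicInt.subring p := by
  have := inv_natCast_mem (p := p) (n := 3 * j + 1) (by
    rintro ⟨d, hd⟩
    have h1 : d < 3 := by
      by_contra! h
      have := Nat.mul_le_mul_left p h
      lia
    interval_cases d <;> lia)
  simpa using this

theorem betaTerm_mem {e : ℕ} (he : p = 6 * e + 1) {j : ℕ} (hj : j < p) :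
    (p : ℚ_[p]) / (3 * (j : ℚ_[p]) + 1) ∈ PadicInt.subring p := by
  rcases eq_or_ne j (2 * e) with rfl | hje
  · have hpe : (p : ℚ_[p]) = 3 * (2 * e : ℕ) + 1 := by
      exact_mod_cast congrArg (Nat.cast (R := ℚ_[p])) (show p = 3 * (2 * e) + 1 by lia)
    rw [← hpe, div_self natCast_prime_ne_zero]
    exact one_mem _
  · rw [div_eq_mul_one_div]
    exact mul_mem (natCast_mem _ _) (prime_mul_inv_mem he hj hje)

theorem betaSum_cong {e : ℕ} (he : p = 6 * e + 1) (he0 : 0 < e) :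
    PCong 2 (∑ j ∈ range p, (p : ℚ_[p]) / (3 * (j : ℚ_[p]) + 1)
        * ((-1 : ℚ_[p]) ^ j * ((3 * e).choose j : ℚ_[p])))
      (((3 * e).choose e : ℚ_[p])
        * (1 + (p : ℚ_[p]) * (1 / 3 * pharm p (2 * e) - 1 / 3 * pharm p e))) := by
  have hS : ∑ j ∈ range p, (p : ℚ_[p]) / (3 * (j : ℚ_[p]) + 1)
        * ((-1 : ℚ_[p]) ^ j * ((3 * e).choose j : ℚ_[p]))
      = p * ∑ j ∈ range (3 * e + 1), (-1) ^ j * ((3 * e).choose j : ℚ_[p]) / (1 + 3 * j) := by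
    rw [mul_sum]
    symm
    refine (sum_subset (range_subset_range.2 (by lia)) fun j _ hj ↦ ?_).trans
      (sum_congr rfl fun j _ ↦ ?_)
    · rw [Nat.choose_eq_zero_of_lt (by simp at hj; lia)]
      simp
    · rw [add_comm 1 (3 * (j : ℚ_[p]))]
      ring
  have hmem : ∑ j ∈ range p, (p : ℚ_[p]) / (3 * (j : ℚ_[p]) + 1)
        * ((-1 : ℚ_[p]) ^ j * ((3 * e).choose j : ℚ_[p]))
      ∈ PadicInt.subring p := sum_mem fun j hj ↦
    mul_mem (betaTerm_mem he (by simpa using hj))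
      (mul_mem (pow_mem (neg_mem (one_mem _)) j) (natCast_mem _ _))
  have hprod := sum_alternating_choose_div (3 : ℚ_[p]) (3 * e) 1
    (fun j ↦ by exact_mod_cast (by lia : 1 + 3 * j ≠ 0))
  rw [prod_three_mul_add_one he] at hprod
  rw [hS] at hmem ⊢
  set S := ∑ j ∈ range (3 * e + 1), (-1) ^ j * ((3 * e).choose j : ℚ_[p]) / (1 + 3 * j)
  have hA := PCong.prod_one_add (s := range (2 * e))
    (a := fun i ↦ -(1 / 3 * (1 / ((i : ℚ_[p]) + 1))))
    (f := fun i ↦ 1 - (p : ℚ_[p]) * (1 / 3 * (1 / ((i : ℚ_[p]) + 1))))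
    (fun i hi ↦ neg_mem (one_third_mul_inv_mem (by lia) (by simp at hi; lia)))
    fun i _ ↦ PCong.of_eq (by ring)
  have hB := PCong.prod_one_add (s := range e)
    (a := fun i ↦ 1 / 3 * (1 / ((i : ℚ_[p]) + 1)))
    (f := fun i ↦ 1 + (p : ℚ_[p]) * (1 / 3 * (1 / ((i : ℚ_[p]) + 1))))
    (fun i hi ↦ one_third_mul_inv_mem (by lia) (by simp at hi; lia))
    fun i _ ↦ PCong.refl _
  rw [sum_neg_distrib, ← mul_sum, ← pharm] at hA
  rw [← mul_sum, ← pharm] at hB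
  have h3 := one_third_mem (p := p) (by lia)
  have hm2 : -(1 / 3 * pharm p (2 * e)) ∈ PadicInt.subring p :=
    neg_mem (mul_mem h3 (pharm_mem (by lia)))
  have hm1 : 1 / 3 * pharm p e ∈ PadicInt.subring p := mul_mem h3 (pharm_mem (by lia))
  have h := PCong.div_one_add (y := 1) (b := 0) (c := (3 * e).choose e) hmem (natCast_mem _ _)
    (add_mem hm2 hm1) (zero_mem _) (PCong.one_add_mul hm2 hm1 hA hB) (PCong.of_eq (by ring)) (by
      have hf : ((3 * e).choose e : ℚ_[p]) * e.factorial * (2 * e).factorial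
          = (3 * e).factorial := by
        have := Nat.choose_mul_factorial_mul_factorial (show e ≤ 3 * e by lia)
        rw [show 3 * e - e = 2 * e by lia] at this
        exact_mod_cast this
      have hn : (3 : ℚ_[p]) ^ (2 * e) * 3 ^ e * e.factorial * (2 * e).factorial ≠ 0 :=
        mul_ne_zero (mul_ne_zero
          (mul_ne_zero (pow_ne_zero _ (by norm_num)) (pow_ne_zero _ (by norm_num)))
          (Nat.cast_ne_zero.2 e.factorial_ne_zero)) (Nat.cast_ne_zero.2 (2 * e).factorial_ne_zero)
      apply mul_right_cancel₀ hn
      rw [← hf, show (3 : ℚ_[p]) ^ (3 * e) = 3 ^ (2 * e) * 3 ^ e by ring] at hprod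
      linear_combination hprod)
  convert h using 3
  ring

theorem harmonic_relation {e : ℕ} (he : p = 6 * e + 1) (he0 : 0 < e) :
    PCong 1 (1 / 3 * pharm p (2 * e) - 1 / 3 * pharm p e
        + (2 * oddHarm p (2 * e) - 1 / 2 * pharm p (2 * e)))
      (1 / 2 * (1 / 3 * pharm p e + 2 / 3 * pharm p (2 * e) - pharm p (3 * e))) := by
  have h1 := (oddHarm_cong (p := p) (m := 3 * e) (n := 2 * e) (by lia) (by lia) (by lia)).mul_left
    (natCast_mem _ 2)
  have h2 := oddHarm_cong (p := p) (m := 3 * e) (n := e) (by lia) (by lia) (by lia)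
  rw [show 3 * e - 2 * e = e by lia] at h1
  rw [show 3 * e - e = 2 * e by lia] at h2
  have h3 := (h1.sub h2).add (PCong.refl (n := 1)
    (1 / 3 * pharm p (2 * e) - 1 / 3 * pharm p e + oddHarm p e - 1 / 2 * pharm p (2 * e)))
  have h4 := pharm_two_mul (p := p) e
  convert h3 using 1
  · push_cast
    ring
  · push_cast
    linear_combination h4

theorem diagSum_one_franelPoly_cong {e : ℕ} (he : p = 6 * e + 1) (he0 : 0 < e) :
    PCong 2 (diagSum p 1 (franelPoly ℚ_[p] p)) (harmValue p e) := by
  rw [diagSum_one_franelPoly, sum_congr rfl fun j _ ↦ mul_franelTerm j]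
  have h2e : 2 * e ∈ range p := by simp; lia
  have hpe : (p : ℚ_[p]) = 3 * (2 * e : ℕ) + 1 := by
    exact_mod_cast congrArg (Nat.cast (R := ℚ_[p])) (show p = 3 * (2 * e) + 1 by lia)
  have hpq : (p : ℚ_[p]) / (3 * (2 * e : ℕ) + 1) = 1 := by
    rw [← hpe, div_self natCast_prime_ne_zero]
  have hb := betaSum_cong he he0
  have hc : (-1) ^ (2 * e) * ((3 * e).choose (2 * e) : ℚ_[p]) = (3 * e).choose e := by
    rw [Nat.choose_symm_of_eq_add (show 3 * e = 2 * e + e by ring)]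
    simp
  rw [← add_sum_erase _ _ h2e, hpq, one_mul] at hb ⊢
  rw [hc] at hb
  have ht := franelTerm_cong (p := p) (m := 3 * e) (by lia) (by lia) (j := 2 * e) (by lia)
  rw [hc] at ht
  have hs : PCong 2
      (∑ j ∈ (range p).erase (2 * e), (p : ℚ_[p]) / (3 * (j : ℚ_[p]) + 1) * franelTerm p j)
      (∑ j ∈ (range p).erase (2 * e), (p : ℚ_[p]) / (3 * (j : ℚ_[p]) + 1)
        * ((-1 : ℚ_[p]) ^ j * ((3 * e).choose j : ℚ_[p]))) := by
    refine PCong.sum fun j hj ↦ ?_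
    obtain ⟨hj1, hj2⟩ := mem_erase.1 hj
    have hjp : j < p := by simpa using hj2
    have h1 : PCong 1 (franelTerm p j) ((-1 : ℚ_[p]) ^ j * ((3 * e).choose j : ℚ_[p])) := by
      rcases le_or_gt j (3 * e) with h | h
      · refine ((franelTerm_cong (m := 3 * e) (by lia) (by lia) h).of_le (by lia)).trans ?_
        refine ⟨(-1 : ℚ_[p]) ^ j * ((3 * e).choose j : ℚ_[p])
            * (2 * oddHarm p j - 1 / 2 * pharm p j),
          mul_mem (mul_mem (pow_mem (neg_mem (one_mem _)) j) (natCast_mem _ _))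
            (sub_mem (mul_mem (natCast_mem _ 2) (oddHarm_mem (by lia)))
              (mul_mem (half_mem (by lia)) (pharm_mem (by lia)))), by ring⟩
      · rw [Nat.choose_eq_zero_of_lt h]
        simpa using franelTerm_cong_zero (m := 3 * e) (by lia) (by lia) h hjp
    convert h1.prime_mul.mul_right (prime_mul_inv_mem he hjp hj1) using 1 <;> ring
  have h := (ht.add hs).add (hb.sub (PCong.refl ((3 * e).choose e : ℚ_[p])))
  have hr := ((harmonic_relation he he0).prime_mul.add (PCong.refl 1)).mul_left
    (natCast_mem _ ((3 * e).choose e))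
  rw [harmValue, add_comm 1]
  refine PCong.trans ?_ hr
  have h' := h.sub (PCong.refl (∑ j ∈ (range p).erase (2 * e), (p : ℚ_[p]) / (3 * (j : ℚ_[p]) + 1)
        * ((-1 : ℚ_[p]) ^ j * ((3 * e).choose j : ℚ_[p]))))
  convert h' using 1 <;> ring

end FranelSum

section Teichmuller

variable {p : ℕ} [Fact p.Prime]

theorem ringHom_padicInt_zmod (φ : ℤ_[p] →+* ZMod p) (x : ℤ_[p]) : φ x = PadicInt.toZMod x := by
  have hx := PadicInt.sub_zmodRepr_mem x
  rw [PadicInt.maximalIdeal_eq_span_p, Ideal.mem_span_singleton] at hx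
  obtain ⟨y, hy⟩ := hx
  rw [sub_eq_iff_eq_add.1 hy]
  simp

/-- The Teichmüller character of `ZMod p` with values in the `p`-adic integers. -/
noncomputable def teichChar (p : ℕ) [Fact p.Prime] : MulChar (ZMod p) ℤ_[p] where
  toMonoidHom := (WittVector.equiv p : WittVector p (ZMod p) →* ℤ_[p]).comp
    (WittVector.teichmuller p)
  map_nonunit' x hx := by
    have : x = 0 := by simpa using hx
    simp [this]

theorem toZMod_teichChar (x : ZMod p) : PadicInt.toZMod (teichChar p x) = x := by
  have h := ringHom_padicInt_zmod ((WittVector.constantCoeff (p := p) (R := ZMod p)).comp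
    (WittVector.equiv p).symm.toRingHom) (teichChar p x)
  rw [← h]
  simp [teichChar, WittVector.constantCoeff]

theorem teichChar_pow_ne_one {n : ℕ} (h : ¬ (p - 1) ∣ n) : teichChar p ^ n ≠ 1 := by
  obtain ⟨g, hg⟩ := IsCyclic.exists_generator (α := (ZMod p)ˣ)
  have ho := orderOf_eq_card_of_forall_mem_zpowers hg
  rw [Nat.card_eq_fintype_card, ZMod.card_units] at ho
  rw [MulChar.ne_one_iff]
  refine ⟨g, fun hc ↦ h ?_⟩
  rw [MulChar.pow_apply_coe] at hc
  have := congrArg PadicInt.toZMod hc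
  rw [map_pow, toZMod_teichChar, map_one] at this
  rw [← ho]
  exact orderOf_dvd_of_pow_eq_one (Units.ext (by simpa using this))

theorem teichChar_pow_card : teichChar p ^ (p - 1) = 1 := by
  rw [← ZMod.card_units p]
  exact (teichChar p).pow_card_eq_one

theorem sum_teichChar_pow {n : ℕ} (hn : 0 < n) :
    ∑ x, teichChar p x ^ n = if (p - 1) ∣ n then (p : ℤ_[p]) - 1 else 0 := by
  rw [sum_congr rfl fun x _ ↦ ((teichChar p).pow_apply' hn.ne' x).symm]
  split_ifs with h
  · obtain ⟨d, rfl⟩ := h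
    rw [pow_mul, teichChar_pow_card, one_pow, MulChar.sum_one_eq_card_units, ZMod.card_units,
      Nat.cast_sub (Fact.out : p.Prime).one_lt.le, Nat.cast_one]
  · exact MulChar.sum_eq_zero_of_ne_one (teichChar_pow_ne_one h)

theorem sum_teichChar_pow_mul {a : ℕ} (ha : 0 < a) (N : ℕ) :
    ∑ x, teichChar p x ^ a * (1 - teichChar p x) ^ N
      = (p - 1) * ∑ j ∈ range (N + 1) with (p - 1) ∣ a + j, (-1) ^ j * (N.choose j : ℤ_[p]) := by
  have h (x : ZMod p) : teichChar p x ^ a * (1 - teichChar p x) ^ N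
      = ∑ j ∈ range (N + 1), (-1) ^ j * (N.choose j : ℤ_[p]) * teichChar p x ^ (a + j) := by
    rw [sub_eq_neg_add, add_pow, mul_sum]
    refine sum_congr rfl fun j _ ↦ ?_
    rw [neg_pow]
    ring
  simp_rw [h]
  rw [sum_comm, sum_filter, mul_sum]
  refine sum_congr rfl fun j _ ↦ ?_
  rw [← mul_sum, sum_teichChar_pow (by lia)]
  split_ifs <;> ring

end Teichmuller

section JacobiCongruence

variable {p : ℕ} [Fact p.Prime]

theorem PadicInt.prime_dvd_iff (x : ℤ_[p]) : (p : ℤ_[p]) ∣ x ↔ PadicInt.toZMod x = 0 := by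
  rw [← RingHom.mem_ker, PadicInt.ker_toZMod, PadicInt.maximalIdeal_eq_span_p,
    Ideal.mem_span_singleton]

theorem filter_dvd_range_three {e : ℕ} (he0 : 0 < e) :
    {j ∈ range (3 * e + 1) | 6 * e ∣ 4 * e + j} = {2 * e} := by
  ext j
  simp only [mem_filter, mem_range, mem_singleton]
  constructor
  · rintro ⟨hj, d, hd⟩
    have h1 : d < 2 := by
      by_contra! h
      have := Nat.mul_le_mul_left (6 * e) h
      lia
    interval_cases d <;> lia
  · rintro rfl
    exact ⟨by lia, 1, by ring⟩

theorem filter_dvd_range_nine {e : ℕ} (he0 : 0 < e) :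
    {j ∈ range (9 * e + 1) | 6 * e ∣ 4 * e + j} = {2 * e, 8 * e} := by
  ext j
  simp only [mem_filter, mem_range, mem_insert, mem_singleton]
  constructor
  · rintro ⟨hj, d, hd⟩
    have h1 : d < 3 := by
      by_contra! h
      have := Nat.mul_le_mul_left (6 * e) h
      lia
    interval_cases d <;> lia
  · rintro (rfl | rfl)
    · exact ⟨by lia, 1, by ring⟩
    · exact ⟨by lia, 2, by ring⟩

/-- The Jacobi sum of the cubic character `teichChar p ^ (4 * e)` and the quadratic character. -/
noncomputable def cubicJacobi (p : ℕ) [Fact p.Prime] (e : ℕ) : ℤ_[p] :=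
  ∑ x : ZMod p, teichChar p x ^ (4 * e) * (quadraticChar (ZMod p) (1 - x) : ℤ_[p])

theorem quadraticChar_term_dvd {e : ℕ} (he : p = 6 * e + 1) (he0 : 0 < e) (x : ZMod p) :
    (p : ℤ_[p]) ^ 2 ∣ 2 * (quadraticChar (ZMod p) (1 - x) : ℤ_[p])
      - (3 * (1 - teichChar p x) ^ (3 * e) - (1 - teichChar p x) ^ (9 * e)) := by
  rcases eq_or_ne x 1 with rfl | hx
  · simp [he0.ne']
  · have hx' : 1 - x ≠ 0 := sub_ne_zero.2 hx.symm
    have hsq : (quadraticChar (ZMod p) (1 - x) : ℤ_[p]) ^ 2 = 1 := by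
      exact_mod_cast congrArg (Int.cast (R := ℤ_[p])) (quadraticChar_sq_one hx')
    have hd : (p : ℤ_[p]) ∣ (1 - teichChar p x) ^ (3 * e) - quadraticChar (ZMod p) (1 - x) := by
      rw [PadicInt.prime_dvd_iff, map_sub, map_pow, map_sub, map_one, toZMod_teichChar,
        map_intCast, quadraticChar_eq_pow_of_char_ne_two' (by rw [ZMod.ringChar_zmod_n]; lia),
        ZMod.card, show p / 2 = 3 * e by lia, sub_self]
    set z : ℤ_[p] := ((quadraticChar (ZMod p) (1 - x) : ℤ) : ℤ_[p])
    set t : ℤ_[p] := (1 - teichChar p x) ^ (3 * e) with ht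
    rw [show 9 * e = 3 * e * 3 by ring, pow_mul, ← ht]
    refine (pow_dvd_pow_of_dvd hd 2).trans ⟨t + 2 * z, ?_⟩
    linear_combination (3 * t - 2 * z) * hsq

theorem cubicJacobi_dvd {e : ℕ} (he : p = 6 * e + 1) (he0 : 0 < e) :
    (p : ℤ_[p]) ^ 2 ∣ 2 * cubicJacobi p e - (p - 1) * (3 * ((3 * e).choose (2 * e))
      - (((9 * e).choose (2 * e)) + ((9 * e).choose (8 * e)))) := by
  have h3 := sum_teichChar_pow_mul (p := p) (a := 4 * e) (by lia) (3 * e)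
  have h9 := sum_teichChar_pow_mul (p := p) (a := 4 * e) (by lia) (9 * e)
  rw [show p - 1 = 6 * e by lia, filter_dvd_range_three he0, sum_singleton] at h3
  rw [show p - 1 = 6 * e by lia, filter_dvd_range_nine he0, sum_pair (by lia)] at h9
  rw [(even_two_mul e).neg_one_pow, one_mul] at h3
  rw [(even_two_mul e).neg_one_pow, show 8 * e = 2 * (4 * e) by ring,
    (even_two_mul (4 * e)).neg_one_pow, one_mul, one_mul] at h9
  have h : 2 * cubicJacobi p e - (p - 1) * (3 * ((3 * e).choose (2 * e))
      - (((9 * e).choose (2 * e)) + ((9 * e).choose (8 * e))))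
      = ∑ x, teichChar p x ^ (4 * e) * (2 * (quadraticChar (ZMod p) (1 - x) : ℤ_[p])
      - (3 * (1 - teichChar p x) ^ (3 * e) - (1 - teichChar p x) ^ (9 * e))) := by
    rw [show 8 * e = 2 * (4 * e) by ring, mul_sub, mul_left_comm, ← h3, ← h9, cubicJacobi,
      mul_sum, mul_sum, ← sum_sub_distrib, ← sum_sub_distrib]
    exact sum_congr rfl fun x _ ↦ by ring
  rw [h]
  exact dvd_sum fun x _ ↦ (quadraticChar_term_dvd he he0 x).mul_left _

theorem choose_add_prime_mul (b n : ℕ) :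
    ((p + b + n).choose n : ℚ_[p])
      = (b + n).choose n * ∏ i ∈ range n, (1 + p * (1 / ((b + i : ℕ) + 1 : ℚ_[p]))) := by
  induction n with
  | zero => simp
  | succ n ih =>
    have h1 : (n : ℚ_[p]) + 1 ≠ 0 := by exact_mod_cast Nat.succ_ne_zero n
    have h2 : (b : ℚ_[p]) + n + 1 ≠ 0 := by exact_mod_cast Nat.succ_ne_zero (b + n)
    have e1 := congrArg (Nat.cast (R := ℚ_[p])) (Nat.add_one_mul_choose_eq (p + b + n) n)
    have e2 := congrArg (Nat.cast (R := ℚ_[p])) (Nat.add_one_mul_choose_eq (b + n) n)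
    push_cast at e1 e2
    rw [prod_range_succ, ← add_assoc, ← add_assoc]
    apply mul_right_cancel₀ h1
    rw [← e1, ih, mul_right_comm, ← e2]
    push_cast
    field_simp
    ring

theorem choose_add_prime_cong {b n : ℕ} (h : b + n < p) :
    PCong 2 ((p + b + n).choose n : ℚ_[p])
      (((b + n).choose n : ℚ_[p]) * (1 + (p : ℚ_[p]) * (pharm p (b + n) - pharm p b))) := by
  rw [choose_add_prime_mul, pharm, sum_range_add, ← pharm, add_sub_cancel_left]
  exact (PCong.prod_one_add (fun i hi ↦ inv_add_one_mem (by simp at hi; lia))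
    fun i _ ↦ PCong.refl _).mul_left (natCast_mem _ _)

theorem PCong.of_dvd {n : ℕ} {x y : ℤ_[p]} (h : (p : ℤ_[p]) ^ n ∣ x - y) :
    PCong n (x : ℚ_[p]) y := by
  obtain ⟨z, hz⟩ := h
  exact ⟨z, z.2, by exact_mod_cast congrArg (Subtype.val) hz⟩

theorem PCong.dvd {n : ℕ} {x y : ℤ_[p]} (h : PCong n (x : ℚ_[p]) y) :
    (p : ℤ_[p]) ^ n ∣ x - y := by
  obtain ⟨z, hz, h⟩ := h
  exact ⟨⟨z, hz⟩, Subtype.ext (by push_cast; exact h)⟩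

theorem choose_pred_three_mul {e : ℕ} (he0 : 0 < e) :
    3 * (3 * e - 1).choose (2 * e) = (3 * e).choose e ∧
      3 * (3 * e - 1).choose e = 2 * (3 * e).choose e := by
  obtain ⟨f, rfl⟩ : ∃ f, e = f + 1 := ⟨e - 1, by lia⟩
  have h1 := Nat.add_one_mul_choose_eq (3 * (f + 1) - 1) f
  have h2 := Nat.add_one_mul_choose_eq (3 * (f + 1) - 1) (2 * f + 1)
  rw [← Nat.choose_symm_of_eq_add (show 3 * (f + 1) - 1 = 2 * (f + 1) + f by lia),
    show 3 * (f + 1) - 1 + 1 = 3 * (f + 1) by lia] at h1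
  rw [← Nat.choose_symm_of_eq_add (show 3 * (f + 1) - 1 = f + 1 + (2 * f + 1) by lia),
    show 3 * (f + 1) - 1 + 1 = 3 * (f + 1) by lia,
    ← Nat.choose_symm_of_eq_add (show 3 * (f + 1) = f + 1 + (2 * f + 1 + 1) by lia)] at h2
  constructor <;> apply Nat.eq_of_mul_eq_mul_right (Nat.succ_pos f)
  · linarith
  · linarith

theorem pharm_pred {n : ℕ} (hn : 0 < n) : pharm p (n - 1) = pharm p n - 1 / n := by
  obtain ⟨m, rfl⟩ : ∃ m, n = m + 1 := ⟨n - 1, by lia⟩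
  simp [pharm_succ]

theorem neg_cubicJacobi_cong {e : ℕ} (he : p = 6 * e + 1) (he0 : 0 < e) :
    PCong 2 ((-cubicJacobi p e : ℤ_[p]) : ℚ_[p]) (harmValue p e) := by
  have hJ := PCong.of_dvd (cubicJacobi_dvd he he0)
  have hpe : (p : ℚ_[p]) = 6 * e + 1 := by
    exact_mod_cast congrArg (Nat.cast (R := ℚ_[p])) he
  have he0' : (e : ℚ_[p]) ≠ 0 := Nat.cast_ne_zero.2 he0.ne'
  have h2 := choose_add_prime_cong (p := p) (b := e - 1) (n := 2 * e) (by lia)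
  have h8 := choose_add_prime_cong (p := p) (b := 2 * e - 1) (n := e) (by lia)
  rw [show p + (e - 1) + 2 * e = 9 * e by lia, show e - 1 + 2 * e = 3 * e - 1 by lia] at h2
  rw [show p + (2 * e - 1) + e = 9 * e by lia, show 2 * e - 1 + e = 3 * e - 1 by lia,
    ← Nat.choose_symm_of_eq_add (show 9 * e = 8 * e + e by ring)] at h8
  obtain ⟨c2, c8⟩ := choose_pred_three_mul he0
  have c2' : (3 : ℚ_[p]) * (3 * e - 1).choose (2 * e) = (3 * e).choose e := by exact_mod_cast c2
  have c8' : (3 : ℚ_[p]) * (3 * e - 1).choose e = 2 * (3 * e).choose e := by exact_mod_cast c8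
  rw [eq_div_of_mul_eq (by norm_num) ((mul_comm _ _).trans c2')] at h2
  rw [eq_div_of_mul_eq (by norm_num) ((mul_comm _ _).trans c8')] at h8
  rw [pharm_pred (by lia : 0 < 3 * e), pharm_pred he0] at h2
  rw [pharm_pred (by lia : 0 < 3 * e), pharm_pred (by lia : 0 < 2 * e)] at h8
  have hm2 : (-1 / 2 : ℚ_[p]) ∈ PadicInt.subring p := by
    rw [neg_div]
    exact neg_mem (half_mem (by lia))
  have hsum := (((PCong.refl (3 * ((3 * e).choose e : ℚ_[p]))).sub (h2.add h8)).mul_left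
    (sub_mem (natCast_mem _ p) (one_mem _)))
  push_cast at hJ
  rw [Nat.choose_symm_of_eq_add (show 3 * e = 2 * e + e by ring)] at hJ
  have h := (hJ.trans hsum).mul_left hm2
  have hJ' : ((-cubicJacobi p e : ℤ_[p]) : ℚ_[p])
      = -1 / 2 * (((2 : ℤ_[p]) : ℚ_[p]) * (cubicJacobi p e : ℚ_[p])) := by
    rw [show ((2 : ℤ_[p]) : ℚ_[p]) = 2 from rfl]
    push_cast
    ring
  rw [← hJ'] at h
  refine h.trans ⟨(3 * e).choose e * (1 / 2 * (pharm p (3 * e)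
    - 1 / 3 * pharm p e - 2 * (1 / 3 * pharm p (2 * e)))), ?_, ?_⟩
  · have h3 := one_third_mem (p := p) (by lia)
    exact mul_mem (natCast_mem _ _) (mul_mem (half_mem (by lia))
      (sub_mem (sub_mem (pharm_mem (by lia)) (mul_mem h3 (pharm_mem (by lia))))
        (mul_mem (natCast_mem _ 2) (mul_mem h3 (pharm_mem (by lia))))))
  · rw [harmValue]
    push_cast
    rw [hpe]
    field_simp
    ring

end JacobiCongruence

section CubicJacobi

variable {p : ℕ} [Fact p.Prime]

theorem sum_quadraticChar_one_sub (hp2 : p ≠ 2) :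
    ∑ x : ZMod p, quadraticChar (ZMod p) (1 - x) = 0 := by
  rw [← quadraticChar_sum_zero (F := ZMod p) (by rwa [ZMod.ringChar_zmod_n])]
  exact (Equiv.subLeft (1 : ZMod p)).sum_comp _

theorem teichChar_pow_pow_three {e : ℕ} (he : p = 6 * e + 1) : (teichChar p ^ (4 * e)) ^ 3 = 1 := by
  rw [← pow_mul, show 4 * e * 3 = (p - 1) * 2 by lia, pow_mul, teichChar_pow_card, one_pow]

theorem teichChar_pow_four_mul_ne_one {e : ℕ} (he : p = 6 * e + 1) (he0 : 0 < e) :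
    teichChar p ^ (4 * e) ≠ 1 := by
  refine teichChar_pow_ne_one fun h ↦ ?_
  have := Nat.le_of_dvd (by lia) h
  lia

theorem cubicJacobi_mul {e : ℕ} (he : p = 6 * e + 1) (he0 : 0 < e) :
    cubicJacobi p e
      * ∑ x : ZMod p, (teichChar p x ^ (4 * e)) ^ 2 * (quadraticChar (ZMod p) (1 - x) : ℤ_[p])
      = p := by
  set X : MulChar (ZMod p) ℚ_[p] :=
    (teichChar p ^ (4 * e)).ringHomComp (PadicInt.Coe.ringHom (p := p)) with hX
  set R : MulChar (ZMod p) ℚ_[p] :=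
    (quadraticChar (ZMod p)).ringHomComp (Int.castRingHom ℚ_[p]) with hR
  have hX3 : X ^ 3 = 1 := by
    rw [hX, MulChar.ringHomComp_pow, teichChar_pow_pow_three he, MulChar.ringHomComp_one]
  have hXinv : X⁻¹ = X ^ 2 := (eq_inv_of_mul_eq_one_left (by rw [← hX3]; rfl)).symm
  have hX1 : X ≠ 1 := (MulChar.ringHomComp_ne_one_iff Subtype.val_injective).2
    (teichChar_pow_four_mul_ne_one he he0)
  have hR2 : R.IsQuadratic := (quadraticChar_isQuadratic (ZMod p)).comp _
  have hR1 : R ≠ 1 := (MulChar.ringHomComp_ne_one_iff Int.cast_injective).2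
    (quadraticChar_ne_one (by rw [ZMod.ringChar_zmod_n]; lia))
  have hXR : X * R ≠ 1 := fun h ↦ hR1 (by
    have h1 : X = R := by rw [eq_inv_of_mul_eq_one_left h, hR2.inv]
    rw [← hX3, h1, pow_succ, hR2.sq_eq_one, one_mul])
  have h := jacobiSum_mul_jacobiSum_inv
    (by rw [ringChar.eq_zero, ZMod.ringChar_zmod_n]; lia) hX1 hR1 hXR
  rw [hXinv, hR2.inv, ZMod.card] at h
  apply PadicInt.ext
  rw [PadicInt.coe_mul, PadicInt.coe_natCast, ← h, cubicJacobi, PadicInt.coe_sum,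
    PadicInt.coe_sum]
  have hXx (x : ZMod p) : X x = (teichChar p x : ℚ_[p]) ^ (4 * e) := by
    simp [hX, MulChar.pow_apply' _ (by lia : 4 * e ≠ 0)]
    rfl
  congr 1
  · exact sum_congr rfl fun x _ ↦ by simp [hXx, hR]
  · exact sum_congr rfl fun x _ ↦ by rw [MulChar.pow_apply' _ two_ne_zero, hXx]; simp [hR]

theorem exists_coords_of_pow_three_eq_one {z s : ℤ_[p]} (hs : s ^ 2 = -3) (hz : z ^ 3 = 1) :
    ∃ a b : ℤ, 2 * z = a + b * s ∧ 2 * z ^ 2 = a - b * s ∧ (a : ZMod 3) = -1 := by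
  have h : (z - 1) * ((2 * z + 1 - s) * (2 * z + 1 + s)) = 0 := by
    linear_combination 4 * hz - (z - 1) * hs
  rcases mul_eq_zero.1 h with h | h
  · obtain rfl := sub_eq_zero.1 h
    exact ⟨2, 0, by simp, by simp, rfl⟩
  have h2 : (2 : ℤ_[p]) ≠ 0 := two_ne_zero
  rcases mul_eq_zero.1 h with h | h
  · refine ⟨-1, 1, by push_cast; linear_combination h, mul_left_cancel₀ h2 ?_, rfl⟩
    push_cast
    linear_combination (2 * z - 1 + s) * h + hs
  · refine ⟨-1, -1, by push_cast; linear_combination h, mul_left_cancel₀ h2 ?_, rfl⟩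
    push_cast
    linear_combination (2 * z - 1 - s) * h + hs

theorem exists_cubicJacobi_eq {e : ℕ} (he : p = 6 * e + 1) (he0 : 0 < e) {s : ℤ_[p]}
    (hs : s ^ 2 = -3) :
    ∃ A B : ℤ, (A : ZMod 3) = -1 ∧ A ^ 2 + 3 * B ^ 2 = p ∧ cubicJacobi p e = A + B * s := by
  have hs0 : s ≠ 0 := by
    rintro rfl
    norm_num at hs
  have h2 : (2 : ℤ_[p]) ≠ 0 := two_ne_zero
  have he4 : 4 * e ≠ 0 := by lia
  have hcoord (x : ZMod p) : ∃ a b : ℤ, 2 * teichChar p x ^ (4 * e) = a + b * s ∧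
      2 * (teichChar p x ^ (4 * e)) ^ 2 = a - b * s ∧ (x ≠ 0 → (a : ZMod 3) = -1) ∧
      (x = 0 → a = 0) := by
    rcases eq_or_ne x 0 with rfl | hx
    · exact ⟨0, 0, by simp [he4, MulChar.map_zero], by simp [he4, MulChar.map_zero],
        by simp, by simp⟩
    · have hz : (teichChar p x ^ (4 * e)) ^ 3 = 1 := by
        have h := congrArg (fun χ : MulChar (ZMod p) ℤ_[p] ↦ χ x) (teichChar_pow_pow_three he)
        simpa only [MulChar.pow_apply' _ he4, MulChar.pow_apply' _ three_ne_zero,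
          MulChar.one_apply hx.isUnit] using h
      obtain ⟨a, b, h1, h2, h3⟩ := exists_coords_of_pow_three_eq_one hs hz
      exact ⟨a, b, h1, h2, fun _ ↦ h3, fun h ↦ absurd h hx⟩
  choose α β hα hβ hα3 hα0 using hcoord
  set ρ : ZMod p → ℤ := fun x ↦ quadraticChar (ZMod p) (1 - x) with hρ
  have hJ : 2 * cubicJacobi p e = ((∑ x, α x * ρ x : ℤ) : ℤ_[p]) + (∑ x, β x * ρ x : ℤ) * s := by
    rw [cubicJacobi, mul_sum]
    push_cast
    rw [sum_mul, ← sum_add_distrib]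
    exact sum_congr rfl fun x _ ↦ by rw [← mul_assoc, hα]; ring
  have hJ' : 2 * ∑ x : ZMod p, (teichChar p x ^ (4 * e)) ^ 2
      * (quadraticChar (ZMod p) (1 - x) : ℤ_[p])
      = ((∑ x, α x * ρ x : ℤ) : ℤ_[p]) - (∑ x, β x * ρ x : ℤ) * s := by
    rw [mul_sum]
    push_cast
    rw [sum_mul, ← sum_sub_distrib]
    exact sum_congr rfl fun x _ ↦ by rw [← mul_assoc, hβ]; ring
  have hβsum : ∑ x, β x = 0 := by
    have h1 : ∑ x, teichChar p x ^ (4 * e) = 0 := by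
      rw [sum_teichChar_pow (by lia), if_neg fun h ↦ ?_]
      have := Nat.le_of_dvd (by lia) h
      lia
    have h2 : ∑ x, (teichChar p x ^ (4 * e)) ^ 2 = 0 := by
      simp_rw [← pow_mul]
      rw [sum_teichChar_pow (by lia), if_neg fun h ↦ ?_]
      obtain ⟨d, hd⟩ := h
      have : d < 2 := by
        by_contra! h
        have := Nat.mul_le_mul_left (p - 1) h
        lia
      interval_cases d <;> lia
    have h3 : 2 * s * ((∑ x, β x : ℤ) : ℤ_[p])
        = 2 * ∑ x, teichChar p x ^ (4 * e) - 2 * ∑ x, (teichChar p x ^ (4 * e)) ^ 2 := by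
      rw [mul_sum, mul_sum, ← sum_sub_distrib, Int.cast_sum, mul_sum]
      exact sum_congr rfl fun x _ ↦ by rw [hα, hβ]; ring
    rw [h1, h2, mul_zero, sub_zero, mul_eq_zero] at h3
    exact_mod_cast h3.resolve_left (mul_ne_zero (by norm_num) hs0)
  have hβ1 : β 1 = 0 := by
    have h1 := hα 1
    have h2 := hβ 1
    rw [map_one, one_pow] at h1 h2
    have : (2 : ℤ_[p]) * s * β 1 = 0 := by linear_combination h2 - h1
    exact_mod_cast (mul_eq_zero.1 this).resolve_left (mul_ne_zero (by norm_num) hs0)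
  have hb : (2 : ℤ) ∣ ∑ x, β x * ρ x := by
    rw [← sub_zero (∑ x, β x * ρ x), ← hβsum, ← sum_sub_distrib]
    refine dvd_sum fun x _ ↦ ?_
    rcases eq_or_ne x 1 with rfl | hx
    · simp [hβ1]
    · rw [← mul_sub_one]
      refine Dvd.dvd.mul_left ?_ _
      rcases quadraticChar_dichotomy (sub_ne_zero.2 hx.symm) with h | h <;> rw [hρ] <;> simp [h]
  have ha3 : ((∑ x, α x * ρ x : ℤ) : ZMod 3) = 1 := by
    have h1 : ∑ x, α x * ρ x = ∑ x, (α x + 1) * ρ x := by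
      simp_rw [add_one_mul]
      rw [sum_add_distrib, sum_quadraticChar_one_sub (by lia), add_zero]
    rw [h1, Int.cast_sum, sum_eq_single 0 (fun x _ hx ↦ by simp [hα3 x hx]) (by simp)]
    simp [hα0 0 rfl, hρ]
  obtain ⟨B, hB⟩ := hb
  set a := ∑ x, α x * ρ x
  set b := ∑ x, β x * ρ x
  have hnorm : a ^ 2 + 3 * b ^ 2 = 4 * p := by
    have h : ((a ^ 2 + 3 * b ^ 2 : ℤ) : ℤ_[p]) = ((4 * p : ℤ) : ℤ_[p]) := by
      have := cubicJacobi_mul he he0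
      push_cast
      rw [← this]
      linear_combination (-2 * ∑ x : ZMod p, (teichChar p x ^ (4 * e)) ^ 2
        * (quadraticChar (ZMod p) (1 - x) : ℤ_[p])) * hJ - (a + b * s) * hJ' + b ^ 2 * hs
    exact_mod_cast h
  have ha : (2 : ℤ) ∣ a := Int.prime_two.dvd_of_dvd_pow (n := 2) ⟨2 * p - 6 * B ^ 2, by
    rw [hB] at hnorm
    linear_combination hnorm⟩
  obtain ⟨A, hA⟩ := ha
  refine ⟨A, B, ?_, ?_, mul_left_cancel₀ h2 ?_⟩
  · rw [hA] at ha3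
    push_cast at ha3
    generalize (A : ZMod 3) = y at ha3
    revert y
    decide
  · rw [hA, hB] at hnorm
    linarith
  · rw [hJ, hA, hB]
    push_cast
    ring

end CubicJacobi

theorem eq_or_eq_neg_of_sq_add_three_mul_sq {n A B u v : ℤ} (hn : n ≠ 0)
    (hA : A ^ 2 + 3 * B ^ 2 = n) (hu : u ^ 2 + 3 * v ^ 2 = n) (h : n ∣ u * B - v * A) :
    (A = u ∧ B = v) ∨ (A = -u ∧ B = -v) := by
  obtain ⟨t, ht⟩ := h
  have hC : (u * A + 3 * v * B) ^ 2 = n ^ 2 * (1 - 3 * t ^ 2) := by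
    linear_combination n * hu + (u ^ 2 + 3 * v ^ 2) * hA - 3 * (u * B - v * A + n * t) * ht
  have hn2 : 0 < n ^ 2 := by positivity
  have ht0 : t = 0 := by
    by_contra h0
    have h1 : 0 < t ^ 2 := by positivity
    nlinarith [sq_nonneg (u * A + 3 * v * B)]
  rw [ht0, mul_zero, sub_eq_zero] at ht
  rw [ht0] at hC
  rcases sq_eq_sq_iff_eq_or_eq_neg.1 (hC.trans (by ring : _ = n ^ 2)) with h | h
  · exact .inl ⟨mul_left_cancel₀ hn (by linear_combination u * h - A * hu - 3 * v * ht),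
      mul_left_cancel₀ hn (by linear_combination v * h - B * hu + u * ht)⟩
  · exact .inr ⟨mul_left_cancel₀ hn (by linear_combination u * h - A * hu - 3 * v * ht),
      mul_left_cancel₀ hn (by linear_combination v * h - B * hu + u * ht)⟩

section Main

variable {p : ℕ} [Fact p.Prime]

theorem not_prime_dvd_cubicJacobi {e : ℕ} (he : p = 6 * e + 1) (he0 : 0 < e) :
    ¬ (p : ℤ_[p]) ∣ cubicJacobi p e := fun hd ↦ by
  have hp : p.Prime := Fact.out
  have h : PCong 1 ((-cubicJacobi p e : ℤ_[p]) : ℚ_[p])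
      ((((3 * e).choose e : ℕ) : ℤ_[p]) : ℚ_[p]) := by
    refine ((neg_cubicJacobi_cong he he0).of_le one_le_two).trans
      ⟨(3 * e).choose e * (1 / 2 * (1 / 3 * pharm p e + 2 * (1 / 3 * pharm p (2 * e))
        - pharm p (3 * e))), ?_, ?_⟩
    · have h3 := one_third_mem (p := p) (by lia)
      exact mul_mem (natCast_mem _ _) (mul_mem (half_mem (by lia))
        (sub_mem (add_mem (mul_mem h3 (pharm_mem (by lia)))
          (mul_mem (natCast_mem _ 2) (mul_mem h3 (pharm_mem (by lia))))) (pharm_mem (by lia))))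
    · rw [harmValue, PadicInt.coe_natCast]
      ring
  have h1 := h.dvd
  rw [pow_one, dvd_sub_right (hd.neg_right), PadicInt.prime_dvd_iff, map_natCast,
    ZMod.natCast_eq_zero_iff] at h1
  have h2 := h1.mul_right (e.factorial * (3 * e - e).factorial)
  rw [← mul_assoc, Nat.choose_mul_factorial_mul_factorial (by lia), hp.dvd_factorial] at h2
  lia

theorem neg_cubicJacobi_eq {e : ℕ} (he : p = 6 * e + 1) (he0 : 0 < e) {u v : ℤ} {s : ℤ_[p]}
    (hs : s ^ 2 = -3) (huv : (p : ℤ) = u ^ 2 + 3 * v ^ 2)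
    (hunit : IsUnit ((u : ℤ_[p]) + v * s)) :
    -cubicJacobi p e = (if (u : ZMod 3) = 1 then 1 else -1) * ((u : ℤ_[p]) + v * s) := by
  obtain ⟨A, B, hA3, hAB, hJ⟩ := exists_cubicJacobi_eq he he0 hs
  have hp : Prime (p : ℤ) := Nat.prime_iff_prime_int.1 Fact.out
  have hconj : (p : ℤ_[p]) ∣ u - v * s := by
    rw [← hunit.dvd_mul_left]
    refine Dvd.intro_left 1 ?_
    have := congrArg (Int.cast (R := ℤ_[p])) huv
    push_cast at this
    linear_combination this + v ^ 2 * hs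
  have hdvd : (p : ℤ) ∣ (u * B - v * A) * (u * B - -v * A) :=
    ⟨B ^ 2 - v ^ 2, by linear_combination -v ^ 2 * hAB - B ^ 2 * huv⟩
  rcases hp.dvd_or_dvd hdvd with h | h
  · rcases eq_or_eq_neg_of_sq_add_three_mul_sq hp.ne_zero hAB huv.symm h with
      ⟨rfl, rfl⟩ | ⟨rfl, rfl⟩
    · rw [hJ, hA3, if_neg (by decide)]
      ring
    · have : (u : ZMod 3) = 1 := by simpa using hA3
      rw [hJ, this, if_pos rfl]
      push_cast
      ring
  · exfalso
    apply not_prime_dvd_cubicJacobi he he0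
    rw [hJ]
    rcases eq_or_eq_neg_of_sq_add_three_mul_sq hp.ne_zero hAB
      (by rw [neg_sq]; exact huv.symm) h with ⟨rfl, rfl⟩ | ⟨rfl, rfl⟩
    · convert hconj using 1
      push_cast
      ring
    · convert hconj.neg_right using 1
      push_cast
      ring

theorem isUnit_twelve (hp3 : 3 < p) : IsUnit (12 : ℤ_[p]) := by
  have h : ¬ p ∣ 12 := fun h ↦ by
    have hp : p.Prime := Fact.out
    rw [show 12 = 2 ^ 2 * 3 by rfl, hp.dvd_mul] at h
    rcases h with h | h
    · have := Nat.le_of_dvd (by lia) (hp.dvd_of_dvd_pow h)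
      lia
    · have := Nat.le_of_dvd (by lia) h
      lia
  rw [PadicInt.isUnit_iff]
  exact (PadicInt.norm_natCast_eq_one_iff (n := 12)).2
    ((Fact.out : p.Prime).coprime_iff_not_dvd.2 h)

theorem coe_inverse_twelve (hp3 : 3 < p) :
    ((Ring.inverse (12 : ℤ_[p]) : ℤ_[p]) : ℚ_[p]) = 1 / 12 := by
  have h := congrArg (fun z : ℤ_[p] ↦ (z : ℚ_[p])) (Ring.mul_inverse_cancel _ (isUnit_twelve hp3))
  rw [PadicInt.coe_mul, PadicInt.coe_one] at h
  exact eq_one_div_of_mul_eq_one_right h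

end Main

/-- For `p ≡ 1 mod 3`, `p = u² + 3v²` with `u + v√-3` a `p`-adic unit,
`∑_{k<p} g_k (-1/12)^k ≡ χ_{-3}(u) (u + v√-3) mod p²`. -/
theorem stmt_3 (p : ℕ) [Fact p.Prime] (hp : 3 < p) (hp3 : p % 3 = 1) (u v : ℤ)
    (s : ℤ_[p]) (hs : s ^ 2 = -3) (huv : (p : ℤ) = u ^ 2 + 3 * v ^ 2)
    (hunit : IsUnit ((u : ℤ_[p]) + v * s)) :
    (p : ℤ_[p]) ^ 2 ∣
      (∑ k ∈ Finset.range p,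
          ((zagierF k : ℤ_[p]) * (-(Ring.inverse (12 : ℤ_[p]))) ^ k))
        - (if (u : ZMod 3) = 1 then (1 : ℤ_[p]) else -1) * ((u : ℤ_[p]) + v * s) := by
  obtain ⟨e, he⟩ : ∃ e, p = 6 * e + 1 := by
    have hodd := (Fact.out : p.Prime).eq_two_or_odd
    exact ⟨p / 6, by lia⟩
  rw [← neg_cubicJacobi_eq he (by lia) hs huv hunit]
  apply PCong.dvd
  refine PCong.trans (PCong.of_eq ?_) (((diagSum_franelPoly_cong hp (k := 2 * e) (by lia)).trans
    (diagSum_one_franelPoly_cong he (by lia))).trans (neg_cubicJacobi_cong he (by lia)).symm)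
  rw [← sum_zagierF_eq_diagSum, PadicInt.coe_sum]
  refine sum_congr rfl fun k _ ↦ ?_
  rw [PadicInt.coe_mul, PadicInt.coe_pow, PadicInt.coe_neg, coe_inverse_twelve hp,
    PadicInt.coe_intCast]
  ring
end
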